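/- arXiv:1006.0732 — 4 statements merged into one kernel-verified Lean document; each statement's English description precedes it below -/
import Mathlib

section
/- Let α, β be nonzero real numbers with α ≠ β, and suppose there exists γ > 1 such that liminf_{n→∞} n^γ · min{‖nβ/α‖, ‖nα/β‖} < ∞. Let f : ℝ → ℂ be measurable, with d₁,d₂,d₃,d₄ ∈ ℂ not all zero satisfying d₁f(x) + d₂f(x+1) + d₃f(x+1)e^{2πiαx} + d₄f(x+1)e^{2πiβx} = 0 for almost every x ∈ ℝ, and suppose f has minimal decay: for almost every x ∈ ℝ, f(x+n) → 0 as n → +∞ and as n → −∞ along the integers. Then f = 0 almost everywhere. -/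
open MeasureTheory Filter

/-- `e x = e^{2πix}`. -/
noncomputable def e (x : ℝ) : ℂ := Complex.exp (2 * Real.pi * Complex.I * x)

/-- `nint x` is the distance from `x` to the nearest integer. -/
noncomputable def nint (x : ℝ) : ℝ := |x - round x|

lemma e_add (x y : ℝ) : e (x + y) = e x * e y := by
  simp only [e]; rw [← Complex.exp_add]; push_cast; ring_nf

lemma e_eq_exp (x : ℝ) : e x = Complex.exp (Complex.I * ((2 * Real.pi * x : ℝ) : ℂ)) := by
  simp only [e]; push_cast; ring_nf

lemma norm_e (x : ℝ) : ‖e x‖ = 1 := by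
  rw [e_eq_exp, mul_comm]; exact Complex.norm_exp_ofReal_mul_I _

lemma e_int (z : ℤ) : e z = 1 := by
  rw [e, Complex.exp_eq_one_iff]; exact ⟨z, by push_cast; ring⟩

lemma e_add_int (x : ℝ) (z : ℤ) : e (x + z) = e x := by
  rw [e_add, e_int, mul_one]

lemma continuous_e : Continuous e := by
  unfold e; fun_prop

lemma exists_e_eq {u : ℂ} (hu : ‖u‖ = 1) : ∃ y : ℝ, e y = u := by
  refine ⟨u.arg / (2 * Real.pi), ?_⟩
  rw [e_eq_exp, mul_div_cancel₀ _ (by positivity), mul_comm]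
  simpa [hu] using Complex.norm_mul_exp_arg_mul_I u

lemma norm_e_sub_one_le (x : ℝ) : ‖e x - 1‖ ≤ 2 * Real.pi * |x| := by
  rw [e_eq_exp]
  refine Real.norm_exp_I_mul_ofReal_sub_one_le.trans_eq ?_
  rw [Real.norm_eq_abs, abs_mul, abs_of_pos (by positivity)]

lemma four_mul_nint_le (x : ℝ) : 4 * nint x ≤ ‖e x - 1‖ := by
  have h1 : e x = e (x - round x) := by
    rw [← e_add_int (x - round x) (round x)]; congr 1; ring
  rw [h1, e_eq_exp, Complex.norm_exp_I_mul_ofReal_sub_one, nint, norm_mul, Real.norm_eq_abs,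
    Real.norm_eq_abs, abs_two]
  have h2 := abs_sub_round x
  have h3 : |2 * Real.pi * (x - round x) / 2| = Real.pi * |x - round x| := by
    rw [mul_assoc, mul_div_cancel_left₀ _ two_ne_zero, abs_mul, abs_of_pos Real.pi_pos]
  have h4 := Real.mul_abs_le_abs_sin (x := 2 * Real.pi * (x - round x) / 2)
    (by rw [h3]; nlinarith [Real.pi_pos])
  rw [h3, ← mul_assoc, div_mul_cancel₀ _ Real.pi_ne_zero] at h4
  linarith

/-- The points `y + k ρ`, `k < n`, are spaced like `n`-th parts of the circle when `ρ` is close to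
a reduced fraction with denominator `n`. -/
lemma sum_div_max_le {n : ℕ} (hn : 0 < n) {m : ℤ} (hmn : IsCoprime m n) {ρ : ℝ}
    (hρ : |n * ρ - m| ≤ 1 / (4 * n)) {δ c : ℝ} (hδ : 0 < δ) (hc : 0 < c) (y : ℝ) :
    ∑ k ∈ Finset.range n, δ / max δ (c * ‖e (y + k * ρ) - 1‖) ≤
      2 + 4 * (n * δ / c) * ∑ l ∈ Finset.range n, ((l : ℝ) + 1)⁻¹ := by
  have hn' : (0 : ℝ) < n := by exact_mod_cast hn
  set a : ℤ := ⌈n * y⌉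
  set L : ℕ → ℕ := fun k => ((a + k * m) % n).toNat
  set G : ℕ → ℝ := fun l => (if l < 2 then 1 else 0) +
    n * δ / c * (3 * ((l : ℝ) + 1)⁻¹ + (((n - 1 - l : ℕ) : ℝ) + 1)⁻¹) with hG
  have hLcast : ∀ k, ((L k : ℕ) : ℤ) = (a + k * m) % n := fun k =>
    Int.toNat_of_nonneg (Int.emod_nonneg _ (by omega))
  have hLlt : ∀ k, L k < n := fun k => by
    have := Int.emod_lt_of_pos (a + k * m) (show (0 : ℤ) < n by omega)
    have := hLcast k
    omega
  have hG0 : ∀ l, 0 ≤ G l := fun l => by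
    simp only [hG]; positivity
  have hinj : Set.InjOn L (Finset.range n) := by
    intro k hk k' hk' h
    have h1 : (a + k * m) % n = (a + k' * m) % n := by rw [← hLcast, ← hLcast, h]
    have h2 : (n : ℤ) ∣ (a + k' * m) - (a + k * m) := Int.ModEq.dvd h1
    rw [show (a + k' * m) - (a + k * m) = ((k' : ℤ) - k) * m by ring] at h2
    have h3 : (n : ℤ) ∣ (k' : ℤ) - k := hmn.symm.dvd_of_dvd_mul_right h2
    have hk := Finset.mem_range.1 hk
    have hk' := Finset.mem_range.1 hk'
    have h4 := Int.eq_zero_of_abs_lt_dvd h3 (by rw [abs_lt]; constructor <;> omega)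
    omega
  have hpt : ∀ k ∈ Finset.range n, δ / max δ (c * ‖e (y + k * ρ) - 1‖) ≤ G (L k) := by
    intro k hk
    have hk : (k : ℝ) < n := by exact_mod_cast Finset.mem_range.1 hk
    by_cases hl : L k < 2
    · have : δ / max δ (c * ‖e (y + k * ρ) - 1‖) ≤ 1 :=
        div_le_one_of_le₀ (le_max_left _ _) (hδ.le.trans (le_max_left _ _))
      refine this.trans ?_
      simp only [hG, hl, if_true]
      have : 0 ≤ n * δ / c * (3 * ((L k : ℝ) + 1)⁻¹ + (((n - 1 - L k : ℕ) : ℝ) + 1)⁻¹) := by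
        positivity
      linarith
    · have hl2 : (2 : ℝ) ≤ L k := by exact_mod_cast not_lt.1 hl
      have hln : (L k : ℝ) + 1 ≤ n := by exact_mod_cast hLlt k
      have hcast : (((n - 1 - L k : ℕ) : ℝ) + 1) = n - L k := by
        have := hLlt k
        rw [Nat.cast_sub (by omega), Nat.cast_sub (by omega)]; push_cast; ring
      set v := y + k * ρ with hv
      have hz : ((L k : ℕ) : ℝ) = a + k * m - n * (((a + k * m) / n : ℤ) : ℝ) := by
        have h1 := hLcast k
        have h2 := Int.mul_ediv_add_emod (a + k * m) n
        have h3 : ((L k : ℕ) : ℤ) = a + k * m - n * ((a + k * m) / n : ℤ) := by linarith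
        exact_mod_cast congrArg (fun z : ℤ => (z : ℝ)) h3
      set z := (a + k * m) / (n : ℤ)
      have ha1 : (a : ℝ) < n * y + 1 := Int.ceil_lt_add_one _
      have ha2 : n * y ≤ (a : ℝ) := Int.le_ceil _
      have herr : |k * (n * ρ - m)| ≤ 1 / 4 := by
        rw [abs_mul, Nat.abs_cast]
        calc (k : ℝ) * |n * ρ - m| ≤ n * (1 / (4 * n)) := by gcongr
          _ = 1 / 4 := by field_simp
      obtain ⟨he1, he2⟩ := abs_le.1 herr
      have hnv : n * (v - z) = L k - (a - n * y) + k * (n * ρ - m) := by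
        rw [hz, hv]; ring
      have hd : (n : ℝ)⁻¹ * (3 / 4 * min ((L k : ℝ) - 1) (n - L k)) ≤ nint v := by
        rw [nint, inv_mul_le_iff₀ hn', ← Nat.abs_cast n, ← abs_mul, Nat.abs_cast]
        have hr : n * (v - round v) = n * (v - z) - n * ((round v - z : ℤ) : ℝ) := by
          push_cast; ring
        rw [hr, hnv]
        have hm1 := min_le_left ((L k : ℝ) - 1) (n - L k)
        have hm2 := min_le_right ((L k : ℝ) - 1) (n - L k)
        rcases le_or_gt (round v - z) 0 with h | h
        · have : ((round v - z : ℤ) : ℝ) ≤ 0 := by exact_mod_cast h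
          refine le_trans ?_ (le_abs_self _)
          nlinarith
        · have : (1 : ℝ) ≤ ((round v - z : ℤ) : ℝ) := by exact_mod_cast h
          refine le_trans ?_ (neg_le_abs _)
          nlinarith
      set μ := min ((L k : ℝ) - 1) (n - L k) with hμ
      have hμpos : 0 < μ := lt_min (by linarith) (by linarith)
      have hμinv : μ⁻¹ ≤ 3 * ((L k : ℝ) + 1)⁻¹ + (n - (L k : ℝ))⁻¹ := by
        have hp1 : 0 < (n - (L k : ℝ))⁻¹ := inv_pos.2 (by linarith)
        have hp2 : 0 < ((L k : ℝ) + 1)⁻¹ := by positivity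
        rcases min_choice ((L k : ℝ) - 1) (n - L k) with h | h
        · rw [hμ, h]
          have : ((L k : ℝ) - 1)⁻¹ ≤ 3 * ((L k : ℝ) + 1)⁻¹ := by
            rw [← div_eq_mul_inv, inv_eq_one_div, div_le_div_iff₀ (by linarith) (by linarith)]
            linarith
          linarith
        · rw [hμ, h]; linarith
      have h4 := four_mul_nint_le v
      simp only [hG, hl, if_false, zero_add, hcast]
      calc δ / max δ (c * ‖e v - 1‖) ≤ δ / (c * ((n : ℝ)⁻¹ * μ)) := by
            refine div_le_div_of_nonneg_left hδ.le (by positivity) ((le_max_right _ _).trans' ?_)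
            gcongr
            nlinarith [mul_pos (inv_pos.2 hn') hμpos]
        _ = n * δ / c * μ⁻¹ := by field_simp
        _ ≤ _ := by gcongr
  calc ∑ k ∈ Finset.range n, δ / max δ (c * ‖e (y + k * ρ) - 1‖)
      ≤ ∑ k ∈ Finset.range n, G (L k) := Finset.sum_le_sum hpt
    _ = ∑ l ∈ (Finset.range n).image L, G l := (Finset.sum_image hinj).symm
    _ ≤ ∑ l ∈ Finset.range n, G l := by
        refine Finset.sum_le_sum_of_subset_of_nonneg ?_ fun l _ _ => hG0 l
        intro l hl
        obtain ⟨k, -, rfl⟩ := Finset.mem_image.1 hl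
        exact Finset.mem_range.2 (hLlt k)
    _ ≤ _ := by
        simp only [hG, Finset.sum_add_distrib, ← Finset.mul_sum]
        rw [Finset.sum_range_reflect (fun l : ℕ => ((l : ℝ) + 1)⁻¹) n, ← Finset.sum_filter]
        have : (∑ l ∈ Finset.range n with l < 2, (1 : ℝ)) ≤ 2 := by
          simp only [Finset.sum_const, nsmul_eq_mul, mul_one]
          have : ((Finset.range n).filter (· < 2)) ⊆ Finset.range 2 := by
            intro l hl; simpa using (Finset.mem_filter.1 hl).2
          exact_mod_cast (Finset.card_le_card this).trans (by simp)
        linarith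

/-- The exponential polynomial `a + b e(αx) + c e(βx)`. -/
noncomputable def trinomial (a b c : ℂ) (α β x : ℝ) : ℂ := a + b * e (α * x) + c * e (β * x)

lemma continuous_trinomial (a b c : ℂ) (α β : ℝ) : Continuous (trinomial a b c α β) := by
  unfold trinomial
  have := continuous_e
  fun_prop

lemma e_mul_add_period {α σ : ℝ} (hσ : |α| * σ = 1) (x : ℝ) (k : ℤ) :
    e (α * (x + k * σ)) = e (α * x) := by
  rcases abs_choice α with h | h <;> rw [h] at hσ
  · rw [show α * (x + k * σ) = α * x + (k : ℤ) by linear_combination (k : ℝ) * hσ, e_add_int]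
  · rw [show α * (x + k * σ) = α * x + ((-k : ℤ) : ℝ) by
      push_cast; linear_combination -(k : ℝ) * hσ, e_add_int]

/-- A point of the unit circle is at least half as far from `v` as from the direction of `v`. -/
lemma exists_norm_sub_le (v : ℂ) :
    ∃ u : ℂ, ‖u‖ = 1 ∧ ∀ w : ℂ, ‖w‖ = 1 → ‖w - u‖ ≤ 2 * ‖w - v‖ := by
  rcases eq_or_ne v 0 with rfl | hv
  · refine ⟨1, by simp, fun w hw => ?_⟩
    have := norm_sub_le w 1
    simp only [sub_zero, hw, norm_one] at this ⊢
    linarith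
  · have hv' : ‖v‖ ≠ 0 := norm_ne_zero_iff.2 hv
    refine ⟨v / ‖v‖, by simp [hv'], fun w hw => ?_⟩
    have h1 : ‖v - v / ‖v‖‖ = |‖v‖ - 1| := by
      have : v - v / ‖v‖ = ((‖v‖ - 1 : ℝ) : ℂ) * (v / ‖v‖) := by
        have : (‖v‖ : ℂ) ≠ 0 := by exact_mod_cast hv'
        push_cast; field_simp
      rw [this, norm_mul, Complex.norm_real, Real.norm_eq_abs]
      simp [hv']
    have h2 : |‖v‖ - 1| ≤ ‖w - v‖ := by
      rw [← hw, norm_sub_rev]; exact abs_norm_sub_norm_le v w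
    have h3 := norm_add_le (w - v) (v - v / ‖v‖)
    rw [sub_add_sub_cancel, h1] at h3
    linarith

lemma sum_div_max_trinomial_le {n : ℕ} (hn : 0 < n) {m : ℤ} (hmn : IsCoprime m n)
    {α β σ : ℝ} (hσ : |α| * σ = 1) (hρ : |n * (β * σ) - m| ≤ 1 / (4 * n))
    {δ : ℝ} (hδ : 0 < δ) (a b : ℂ) {c : ℂ} (hc : c ≠ 0) (x : ℝ) :
    ∑ k ∈ Finset.range n, δ / max δ ‖trinomial a b c α β (x + k * σ)‖ ≤
      2 + 8 / ‖c‖ * (n * δ) * ∑ l ∈ Finset.range n, ((l : ℝ) + 1)⁻¹ := by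
  have hc' : 0 < ‖c‖ := norm_pos_iff.2 hc
  obtain ⟨u, hu, hu'⟩ := exists_norm_sub_le (-(a + b * e (α * x)) / c)
  obtain ⟨y, hy⟩ := exists_e_eq (u := e (β * x) / u) (by rw [norm_div, norm_e, hu, div_one])
  have hu0 : u ≠ 0 := norm_ne_zero_iff.1 (by rw [hu]; exact one_ne_zero)
  have hpt : ∀ k ∈ Finset.range n, δ / max δ ‖trinomial a b c α β (x + k * σ)‖ ≤
      δ / max δ (‖c‖ / 2 * ‖e (y + k * (β * σ)) - 1‖) := by
    intro k _
    refine div_le_div_of_nonneg_left hδ.le (lt_max_of_lt_left hδ) (max_le_max_left _ ?_)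
    have h1 := hu' (e (β * (x + k * σ))) (norm_e _)
    have h2 : trinomial a b c α β (x + k * σ) =
        c * (e (β * (x + k * σ)) - -(a + b * e (α * x)) / c) := by
      have := e_mul_add_period hσ x k
      rw [Int.cast_natCast] at this
      rw [trinomial, this]; field_simp; ring
    have h3 : e (β * (x + k * σ)) - u = u * (e (y + k * (β * σ)) - 1) := by
      rw [e_add, hy, show β * (x + k * σ) = β * x + k * (β * σ) by ring, e_add]
      field_simp
    rw [h3, norm_mul, hu, one_mul] at h1
    rw [h2, norm_mul]
    nlinarith
  refine (Finset.sum_le_sum hpt).trans ((sum_div_max_le hn hmn hρ hδ (by positivity) y).trans_eq ?_)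
  field_simp
  ring

lemma setLIntegral_Ico_le_nat_mul {h : ℝ → ENNReal} {L : ℝ} {C : ENNReal}
    (hL : 0 ≤ L) (hh : ∀ b, ∫⁻ x in Set.Ico b (b + L), h x ≤ C) (p : ℕ) (b : ℝ) :
    ∫⁻ x in Set.Ico b (b + p * L), h x ≤ p * C := by
  induction p with
  | zero => simp
  | succ p ih =>
    have : Set.Ico b (b + (p + 1 : ℕ) * L) =
        Set.Ico b (b + p * L) ∪ Set.Ico (b + p * L) (b + p * L + L) := by
      rw [Set.Ico_union_Ico_eq_Ico (by nlinarith [p.cast_nonneg (α := ℝ)]) (by linarith)]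
      push_cast; ring_nf
    rw [this]
    refine (lintegral_union_le _ _ _).trans ?_
    push_cast
    rw [add_mul, one_mul]
    exact add_le_add ih (hh _)

lemma setLIntegral_Ico_sum {h : ℝ → ENNReal} (hh : Measurable h) {σ : ℝ} (hσ : 0 ≤ σ)
    (b : ℝ) (n : ℕ) :
    ∫⁻ x in Set.Ico b (b + σ), ∑ k ∈ Finset.range n, h (x + k * σ) =
      ∫⁻ x in Set.Ico b (b + n * σ), h x := by
  induction n with
  | zero => simp
  | succ n ih =>
    have hU : Set.Ico b (b + (n + 1 : ℕ) * σ) =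
        Set.Ico b (b + n * σ) ∪ Set.Ico (b + n * σ) (b + n * σ + σ) := by
      rw [Set.Ico_union_Ico_eq_Ico (by nlinarith [n.cast_nonneg (α := ℝ)]) (by linarith)]
      push_cast; ring_nf
    have hmp := (measurePreserving_add_right (volume : Measure ℝ)
      (n * σ)).setLIntegral_comp_preimage (measurableSet_Ico (a := b + n * σ) (b := b + n * σ + σ)) hh
    have hpre : (fun x : ℝ => x + n * σ) ⁻¹' Set.Ico (b + n * σ) (b + n * σ + σ) =
        Set.Ico b (b + σ) := by
      rw [Set.preimage_add_const_Ico]; congr 1 <;> ring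
    rw [hpre] at hmp
    rw [hU, lintegral_union measurableSet_Ico (by
      rw [Set.disjoint_left]; intro x hx hx'; exact absurd hx.2 (not_lt.2 hx'.1)), ← ih, ← hmp]
    simp_rw [Finset.sum_range_succ]
    exact lintegral_add_right _ (by fun_prop)

/-- On a short interval a function is small only near one point where its derivative is large. -/
lemma volume_small_of_deriv_large {g g' : ℝ → ℂ} (hg : ∀ x, HasDerivAt g (g' x) x) {M : ℝ}
    (hM : ∀ x y, ‖g' x - g' y‖ ≤ M * |x - y|) {κ δ ℓ : ℝ} (hκ : 0 < κ) (hM0 : 0 ≤ M)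
    (hℓ : M * ℓ ≤ κ / 2) (b : ℝ) :
    volume ({x | ‖g x‖ < δ ∧ κ ≤ ‖g' x‖} ∩ Set.Ico b (b + ℓ)) ≤ ENNReal.ofReal (8 * δ / κ) := by
  set S := {x | ‖g x‖ < δ ∧ κ ≤ ‖g' x‖} ∩ Set.Ico b (b + ℓ)
  rcases S.eq_empty_or_nonempty with h | ⟨x₀, ⟨hx₀, hx₀'⟩, hx₀I⟩
  · rw [h]; simp
  have hsub : S ⊆ Metric.closedBall x₀ (4 * δ / κ) := by
    rintro x ⟨⟨hx, -⟩, hxI⟩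
    have h1 := (convex_Ico b (b + ℓ)).norm_image_sub_le_of_norm_hasDerivWithin_le
      (f := fun x => g x - g' x₀ * x) (f' := fun x => g' x - g' x₀) (C := κ / 2)
      (fun y _ => ((hg y).sub (by
        simpa using (Complex.ofRealCLM.hasDerivAt (x := y)).const_mul (g' x₀))).hasDerivWithinAt)
      (fun y hy => (hM y x₀).trans ((mul_le_mul_of_nonneg_left (by
        rw [abs_le]; constructor <;> linarith [hy.1, hy.2, hx₀I.1, hx₀I.2]) hM0).trans hℓ))
      hx₀I hxI
    have h2 : g' x₀ * ((x - x₀ : ℝ) : ℂ) =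
        g x - g x₀ - (g x - g' x₀ * x - (g x₀ - g' x₀ * x₀)) := by push_cast; ring
    have h3 : ‖g' x₀‖ * |x - x₀| ≤ ‖g x‖ + ‖g x₀‖ + κ / 2 * |x - x₀| := by
      rw [← Real.norm_eq_abs, ← Complex.norm_real, ← norm_mul, h2]
      refine (norm_sub_le _ _).trans (add_le_add (norm_sub_le _ _) ?_)
      rw [Complex.norm_real]; exact h1
    rw [Metric.mem_closedBall, Real.dist_eq, le_div_iff₀ hκ]
    nlinarith [abs_nonneg (x - x₀)]
  refine (measure_mono hsub).trans ?_
  rw [Real.volume_closedBall]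
  apply ENNReal.ofReal_le_ofReal
  apply le_of_eq; ring

lemma norm_e_sub_e_le (x y : ℝ) : ‖e x - e y‖ ≤ 2 * Real.pi * |x - y| := by
  have h : e x - e y = e y * (e (x - y) - 1) := by
    rw [mul_sub, ← e_add, mul_one]; congr 2; ring
  rw [h, norm_mul, norm_e, one_mul]
  exact norm_e_sub_one_le _

lemma hasDerivAt_e_mul (α x : ℝ) :
    HasDerivAt (fun x : ℝ => e (α * x)) (2 * Real.pi * Complex.I * (α * e (α * x))) x := by
  have h1 : HasDerivAt (fun x : ℝ => 2 * Real.pi * Complex.I * ((α * x : ℝ) : ℂ))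
      (2 * Real.pi * Complex.I * α) x := by
    have := (((hasDerivAt_id x).const_mul α).ofReal_comp).const_mul (2 * Real.pi * Complex.I)
    simpa using this
  have h2 := h1.cexp
  simp only [e]
  convert h2 using 1
  ring

lemma volume_arc_le {α σ : ℝ} (hσ : |α| * σ = 1) (z : ℂ) (ε x₀ : ℝ) :
    volume ({x | ‖e (α * x) - z‖ ≤ ε} ∩ Set.Ico x₀ (x₀ + σ)) ≤ ENNReal.ofReal (3 * (ε * σ)) := by
  set S := {x | ‖e (α * x) - z‖ ≤ ε} ∩ Set.Ico x₀ (x₀ + σ)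
  rcases S.eq_empty_or_nonempty with h | ⟨y, hy, hyI⟩
  · rw [h]; simp
  have hε : 0 ≤ ε := (norm_nonneg _).trans hy
  have hα : 0 < |α| := by
    rcases (abs_nonneg α).eq_or_lt with h | h
    · rw [← h] at hσ; simp at hσ
    · exact h
  have hσ0 : 0 < σ := by
    by_contra h
    nlinarith
  have hsub : S ⊆ Metric.closedBall y (ε / 2 * σ) ∪ Metric.closedBall (y + σ) (ε / 2 * σ) ∪
      Metric.closedBall (y - σ) (ε / 2 * σ) := by
    rintro x ⟨hx, hxI⟩
    have h1 : ‖e (|α| * (x - y)) - 1‖ ≤ 2 * ε := by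
      have h2 : ‖e (α * x) - e (α * y)‖ ≤ 2 * ε := by
        have := norm_sub_le (e (α * x) - z) (e (α * y) - z)
        rw [sub_sub_sub_cancel_right] at this
        simp only [Set.mem_ofPred_eq] at hx hy
        linarith
      have key : ∀ s t : ℝ, ‖e (s - t) - 1‖ = ‖e s - e t‖ := fun s t => by
        rw [← one_mul ‖e (s - t) - 1‖, ← norm_e t, ← norm_mul, mul_sub, ← e_add, mul_one]
        congr 3; ring
      rcases abs_choice α with h | h <;> rw [h]
      · rw [mul_sub, key]; exact h2
      · rw [show -α * (x - y) = α * y - α * x by ring, key, norm_sub_rev]; exact h2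
    have h3 := (four_mul_nint_le _).trans h1
    rw [nint] at h3
    set r := round (|α| * (x - y))
    have h4 : |x - y - r * σ| ≤ ε / 2 * σ := by
      have : x - y - r * σ = σ * (|α| * (x - y) - r) := by
        linear_combination (-(x - y)) * hσ
      rw [this, abs_mul, abs_of_pos hσ0]
      nlinarith
    have hlt : |(|α| * (x - y))| < 1 := by
      rw [abs_mul, abs_abs, ← hσ]
      exact mul_lt_mul_of_pos_left
        (by rw [abs_lt]; constructor <;> linarith [hxI.1, hxI.2, hyI.1, hyI.2]) hα
    obtain ⟨hl1, hl2⟩ := abs_lt.1 hlt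
    have h5 := abs_le.1 (abs_sub_round (|α| * (x - y)))
    have hr1 : (-2 : ℝ) < r := by linarith [h5.2]
    have hr2 : (r : ℝ) < 2 := by linarith [h5.1]
    have hr1' : -2 < r := by exact_mod_cast hr1
    have hr2' : r < 2 := by exact_mod_cast hr2
    simp only [Set.mem_union, Metric.mem_closedBall, Real.dist_eq]
    have : r = -1 ∨ r = 0 ∨ r = 1 := by omega
    rcases this with h | h | h <;> rw [h] at h4
    · right; convert h4 using 2; push_cast; ring
    · left; left; convert h4 using 2; push_cast; ring
    · left; right; convert h4 using 2; push_cast; ring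
  refine (measure_mono hsub).trans ((measure_union_le _ _).trans
    ((add_le_add_left (measure_union_le _ _) _).trans ?_))
  simp only [Real.volume_closedBall]
  rw [← ENNReal.ofReal_add (by positivity) (by positivity),
    ← ENNReal.ofReal_add (by positivity) (by positivity)]
  apply ENNReal.ofReal_le_ofReal
  apply le_of_eq; ring

lemma exists_volume_small_trinomial_le (a : ℂ) {b c : ℂ} (hb : b ≠ 0) {α β σ : ℝ}
    (hβ : β ≠ 0) (hαβ : α ≠ β) (hσ : |α| * σ = 1) {η C : ℝ} (hη : 0 < η) (hC : 0 < C) :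
    ∃ ζ > 0, ∀ (n : ℕ) (δ : ℝ), 0 < n → 0 < δ → n * δ ≤ ζ →
      (∀ x, ∑ k ∈ Finset.range n, δ / max δ ‖trinomial a b c α β (x + k * σ)‖ ≤ C) →
      ∀ x₀, volume ({x | ‖trinomial a b c α β x‖ < δ} ∩ Set.Ico x₀ (x₀ + n * σ)) ≤
        ENNReal.ofReal η := by
  have hσ0 : 0 < σ := by
    by_contra h
    nlinarith [abs_nonneg α]
  set g := trinomial a b c α β with hg
  set g' : ℝ → ℂ := fun x => 2 * Real.pi * Complex.I * (b * (α * e (α * x)) + c * (β * e (β * x)))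
    with hg'
  have hgd : ∀ x, HasDerivAt g (g' x) x := by
    intro x
    have := (((hasDerivAt_e_mul α x).const_mul b).const_add a).add
      ((hasDerivAt_e_mul β x).const_mul c)
    exact this.congr_deriv (by simp only [hg']; ring)
  set M := 2 * Real.pi * (‖b‖ * (|α| * (2 * Real.pi * |α|)) + ‖c‖ * (|β| * (2 * Real.pi * |β|)))
    with hMdef
  have hM0 : 0 ≤ M := by positivity
  have hM : ∀ x y, ‖g' x - g' y‖ ≤ M * |x - y| := by
    intro x y
    have h1 : g' x - g' y = 2 * Real.pi * Complex.I * (b * (α * (e (α * x) - e (α * y))) +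
      c * (β * (e (β * x) - e (β * y)))) := by simp only [hg']; ring
    have h2 : ∀ γ : ℝ, ‖e (γ * x) - e (γ * y)‖ ≤ 2 * Real.pi * |γ| * |x - y| := fun γ => by
      refine (norm_e_sub_e_le _ _).trans_eq ?_
      rw [← mul_sub, abs_mul]; ring
    have h3 : ‖(2 * Real.pi * Complex.I : ℂ)‖ = 2 * Real.pi := by
      simp [abs_of_pos Real.pi_pos]
    rw [h1, norm_mul, h3, hMdef, mul_assoc (2 * Real.pi)]
    refine mul_le_mul_of_nonneg_left ?_ (by positivity)
    refine (norm_add_le _ _).trans ?_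
    rw [norm_mul, norm_mul, norm_mul, norm_mul, Complex.norm_real, Complex.norm_real,
      Real.norm_eq_abs, Real.norm_eq_abs]
    calc _ ≤ ‖b‖ * (|α| * (2 * Real.pi * |α| * |x - y|)) +
        ‖c‖ * (|β| * (2 * Real.pi * |β| * |x - y|)) := by gcongr <;> exact h2 _
      _ = _ := by ring
  set B : ℂ := b * (1 - α / β) with hB
  have hβ' : (β : ℂ) ≠ 0 := by exact_mod_cast hβ
  have hB0 : B ≠ 0 := by
    refine mul_ne_zero hb ?_
    rw [sub_ne_zero, ne_comm, Ne, div_eq_one_iff_eq hβ']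
    exact_mod_cast hαβ
  have hB0' : 0 < ‖B‖ := norm_pos_iff.2 hB0
  set K := (1 + 1 / (2 * Real.pi * |β|)) / ‖B‖ with hK
  have hβa : 0 < |β| := abs_pos.2 hβ
  have hK0 : 0 < K := by positivity
  set κ := η / (6 * C * K * σ) with hκ
  have hκ0 : 0 < κ := by positivity
  have harc : ∀ x, ‖g x‖ ≤ κ → ‖g' x‖ ≤ κ → ‖e (α * x) - -a / B‖ ≤ K * κ := by
    intro x h1 h2
    have hπ : (Real.pi : ℂ) ≠ 0 := by exact_mod_cast Real.pi_ne_zero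
    have h3 : e (α * x) - -a / B = (g x - g' x / (2 * Real.pi * Complex.I * β)) / B := by
      rw [eq_div_iff hB0, sub_mul, div_mul_cancel₀ _ hB0]
      simp only [hg, hg', hB, trinomial]
      field_simp [Complex.I_ne_zero]
      ring
    rw [h3, norm_div, hK, div_mul_eq_mul_div]
    refine div_le_div_of_nonneg_right ?_ hB0'.le
    refine (norm_sub_le _ _).trans ?_
    rw [norm_div]
    have h4 : ‖(2 * Real.pi * Complex.I * β : ℂ)‖ = 2 * Real.pi * |β| := by
      simp [abs_of_pos Real.pi_pos]
    rw [h4, add_mul, one_mul, one_div_mul_eq_div]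
    gcongr
  obtain ⟨p, hp⟩ := exists_nat_gt (2 * M * σ / κ)
  have hp0 : (0 : ℝ) < p := lt_of_le_of_lt (by positivity) hp
  have hℓ : M * (σ / p) ≤ κ / 2 := by
    rw [div_lt_iff₀ hκ0] at hp
    rw [← mul_div_assoc, div_le_iff₀ hp0]
    linarith
  refine ⟨min κ (η * κ / (16 * p)), lt_min hκ0 (by positivity), ?_⟩
  intro n δ hn hδ hnδ hsum x₀
  have hn1 : (1 : ℝ) ≤ n := by exact_mod_cast hn
  have hδκ : δ ≤ κ := by nlinarith [hnδ.trans (min_le_left _ _)]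
  have hcg : Continuous g := continuous_trinomial _ _ _ _ _
  have hcg' : Continuous g' := by
    have := continuous_e
    simp only [hg']; fun_prop
  set S₁ := {x | ‖g x‖ < δ ∧ κ ≤ ‖g' x‖}
  set S₂ := {x | ‖g x‖ < δ ∧ ‖e (α * x) - -a / B‖ ≤ K * κ}
  have hS₁m : MeasurableSet S₁ :=
    (measurableSet_lt hcg.norm.measurable measurable_const).inter
      (measurableSet_le measurable_const hcg'.norm.measurable)
  have hcarc : Continuous fun x => ‖e (α * x) - -a / B‖ := by
    have := continuous_e
    fun_prop
  have hS₂m : MeasurableSet S₂ :=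
    (measurableSet_lt hcg.norm.measurable measurable_const).inter
      (measurableSet_le hcarc.measurable measurable_const)
  have hsub : {x | ‖g x‖ < δ} ∩ Set.Ico x₀ (x₀ + n * σ) ⊆
      (S₁ ∩ Set.Ico x₀ (x₀ + n * σ)) ∪ (S₂ ∩ Set.Ico x₀ (x₀ + n * σ)) := by
    rintro x ⟨hx, hxI⟩
    rcases le_or_gt κ ‖g' x‖ with h | h
    · exact Or.inl ⟨⟨hx, h⟩, hxI⟩
    · exact Or.inr ⟨⟨hx, harc x (hx.le.trans hδκ) h.le⟩, hxI⟩
  have hind : ∀ {S : Set ℝ}, MeasurableSet S → ∀ I : Set ℝ,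
      ∫⁻ x in I, S.indicator 1 x = volume (S ∩ I) := fun hS I => by
    rw [lintegral_indicator_one hS, Measure.restrict_apply hS]
  have h₁ : volume (S₁ ∩ Set.Ico x₀ (x₀ + n * σ)) ≤ ENNReal.ofReal (η / 2) := by
    have := setLIntegral_Ico_le_nat_mul (h := S₁.indicator 1) (L := σ / p)
      (C := ENNReal.ofReal (8 * δ / κ)) (by positivity)
      (fun y => by rw [hind hS₁m]; exact volume_small_of_deriv_large hgd hM hκ0 hM0 hℓ y)
      (n * p) x₀
    rw [hind hS₁m, show x₀ + ((n * p : ℕ) : ℝ) * (σ / p) = x₀ + n * σ by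
      push_cast; field_simp] at this
    refine this.trans ?_
    rw [← ENNReal.ofReal_natCast, ← ENNReal.ofReal_mul (by positivity)]
    apply ENNReal.ofReal_le_ofReal
    have h5 := hnδ.trans (min_le_right _ _)
    rw [le_div_iff₀ (by positivity)] at h5
    push_cast
    rw [← mul_div_assoc, div_le_iff₀ hκ0]
    nlinarith
  have h₂ : volume (S₂ ∩ Set.Ico x₀ (x₀ + n * σ)) ≤ ENNReal.ofReal (η / 2) := by
    set A := {x | ‖e (α * x) - -a / B‖ ≤ K * κ}
    have hAm : MeasurableSet A := measurableSet_le hcarc.measurable measurable_const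
    rw [← hind hS₂m, ← setLIntegral_Ico_sum (measurable_one.indicator hS₂m) hσ0.le]
    calc ∫⁻ x in Set.Ico x₀ (x₀ + σ), ∑ k ∈ Finset.range n, S₂.indicator 1 (x + k * σ)
        ≤ ∫⁻ x in Set.Ico x₀ (x₀ + σ), A.indicator 1 x * ENNReal.ofReal C := by
          refine lintegral_mono fun x => ?_
          by_cases hx : x ∈ A
          · rw [Set.indicator_of_mem hx, Pi.one_apply, one_mul]
            refine le_trans ?_ (ENNReal.ofReal_le_ofReal (hsum x))
            rw [ENNReal.ofReal_sum_of_nonneg fun k _ => by positivity]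
            refine Finset.sum_le_sum fun k _ => ?_
            by_cases hxk : x + k * σ ∈ S₂
            · rw [max_eq_left hxk.1.le, div_self hδ.ne', ENNReal.ofReal_one]
              exact Set.indicator_le_self' (fun _ _ => zero_le) _
            · rw [Set.indicator_of_notMem hxk]; exact zero_le
          · rw [Finset.sum_eq_zero]
            · exact zero_le
            · intro k _
              refine Set.indicator_of_notMem (fun h => hx ?_) _
              have := h.2
              have h6 := e_mul_add_period hσ x k
              rw [Int.cast_natCast] at h6
              rwa [h6] at this
      _ = volume (A ∩ Set.Ico x₀ (x₀ + σ)) * ENNReal.ofReal C := by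
          rw [lintegral_mul_const _ (measurable_one.indicator hAm), hind hAm]
      _ ≤ ENNReal.ofReal (3 * (K * κ * σ)) * ENNReal.ofReal C := by
          gcongr; exact volume_arc_le hσ _ _ _
      _ = ENNReal.ofReal (η / 2) := by
          rw [← ENNReal.ofReal_mul (by positivity)]
          congr 1
          rw [hκ]; field_simp; ring
  refine (measure_mono hsub).trans ((measure_union_le _ _).trans ((add_le_add h₁ h₂).trans_eq ?_))
  rw [← ENNReal.ofReal_add (by positivity) (by positivity), add_halves]

lemma setLIntegral_sum_translate_le {h : ℝ → ENNReal} (hh : Measurable h) {L : ℝ} {C : ENNReal}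
    (hL : 0 ≤ L) (hC : ∀ b, ∫⁻ x in Set.Ico b (b + L), h x ≤ C) {N p : ℕ} (hN : N ≤ p * L)
    (A t : ℝ) :
    ∫⁻ x in Set.Ico A (A + 1), ∑ i ∈ Finset.range N, h (x - t + i) ≤ p * C := by
  have hmp := (measurePreserving_add_right (volume : Measure ℝ) (-t)).setLIntegral_comp_preimage
    (measurableSet_Ico (a := A - t) (b := A - t + 1))
    (f := fun x => ∑ i ∈ Finset.range N, h (x + i)) (by fun_prop)
  rw [Set.preimage_add_const_Ico, show A - t - -t = A by ring,
    show A - t + 1 - -t = A + 1 by ring] at hmp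
  simp only [← sub_eq_add_neg] at hmp
  rw [hmp]
  have := setLIntegral_Ico_sum hh zero_le_one (A - t) N
  simp only [mul_one] at this
  rw [this]
  refine (lintegral_mono_set (Set.Ico_subset_Ico_right ?_)).trans
    (setLIntegral_Ico_le_nat_mul hL hC p (A - t))
  linarith

lemma exists_natCast_mul_rpow_sum_le {γ : ℝ} (hγ : 1 < γ) :
    ∃ S > 0, ∀ n : ℕ, 0 < n →
      n * (n : ℝ) ^ (-γ) * ∑ l ∈ Finset.range n, ((l : ℝ) + 1)⁻¹ ≤ S := by
  have hs := (summable_nat_add_iff 1).2 (Real.summable_nat_rpow_inv.2 hγ)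
  refine ⟨∑' l : ℕ, (((l + 1 : ℕ) : ℝ) ^ γ)⁻¹ + 1, by positivity, fun n hn => ?_⟩
  refine le_trans ?_ ((hs.sum_le_tsum (Finset.range n) fun _ _ => by positivity).trans
    (le_add_of_nonneg_right zero_le_one))
  rw [Finset.mul_sum]
  refine Finset.sum_le_sum fun l hl => ?_
  have hn' : (0 : ℝ) < n := by exact_mod_cast hn
  have hl0 : (0 : ℝ) < (l : ℝ) + 1 := by positivity
  have hln : (l : ℝ) + 1 ≤ n := by exact_mod_cast Finset.mem_range.1 hl
  push_cast
  have h1 : (n : ℝ) * (n : ℝ) ^ (-γ) = (n : ℝ) ^ (-(γ - 1)) := by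
    rw [← Real.rpow_one_add' hn'.le (by linarith)]; congr 1; ring
  have h2 : (((l : ℝ) + 1) ^ γ)⁻¹ = ((l : ℝ) + 1) ^ (-(γ - 1)) * ((l : ℝ) + 1)⁻¹ := by
    rw [← Real.rpow_neg hl0.le, ← Real.rpow_neg_one ((l : ℝ) + 1), ← Real.rpow_add hl0]
    congr 1; ring
  rw [h1, h2]
  gcongr 1
  exact Real.rpow_le_rpow_of_nonpos hl0 hln (by linarith)

lemma prod_norm_le_exp {N : ℕ} {u v : ℕ → ℂ} {δ : ℝ} (hδ : 0 < δ)
    (huv : ∀ i, ‖v i - u i‖ ≤ δ) (hu : ∀ i < N, δ ≤ ‖u i‖) :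
    ∏ i ∈ Finset.range N, ‖v i‖ ≤ Real.exp (∑ i ∈ Finset.range N, δ / max δ ‖u i‖) *
      ∏ i ∈ Finset.range N, ‖u i‖ := by
  rw [Real.exp_sum, ← Finset.prod_mul_distrib]
  refine Finset.prod_le_prod (fun _ _ => norm_nonneg _) fun i hi => ?_
  have h1 := hu i (Finset.mem_range.1 hi)
  have h2 : 0 < ‖u i‖ := hδ.trans_le h1
  rw [max_eq_right h1]
  have h3 := Real.add_one_le_exp (δ / ‖u i‖)
  calc ‖v i‖ ≤ ‖u i‖ + δ := by
        have := norm_add_le (u i) (v i - u i)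
        rw [add_sub_cancel] at this
        linarith [huv i]
    _ = (δ / ‖u i‖ + 1) * ‖u i‖ := by field_simp; ring
    _ ≤ _ := by gcongr

/-- `Q` has arbitrarily long almost periods `T`, in the sense that the products of `N ≈ j T`
consecutive values of `Q` starting at `x` and at `x - j T` are comparable for most `x`. -/
def HasAlmostPeriods (Q : ℝ → ℂ) : Prop :=
  ∀ (A : ℤ) (J : ℕ) (κ : ℝ), 0 < κ → ∃ R : ℝ, ∀ N₀ : ℕ, ∃ T : ℝ, N₀ ≤ T ∧
    ∀ j N : ℕ, j ≤ J → N ≤ j * T + 1 →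
      volume {x | x ∈ Set.Ico (A : ℝ) (A + 1) ∧ R * ∏ i ∈ Finset.range N, ‖Q (x - j * T + i)‖ <
        ∏ i ∈ Finset.range N, ‖Q (x + i)‖} ≤ ENNReal.ofReal κ

lemma hasAlmostPeriods_of_periodic {Q : ℝ → ℂ} {T : ℝ} (hT : 0 < T) (hQ : Function.Periodic Q T) :
    HasAlmostPeriods Q := by
  intro A J κ hκ
  refine ⟨1, fun N₀ => ?_⟩
  obtain ⟨k, hk⟩ := exists_nat_ge (N₀ / T)
  refine ⟨k * T, (div_le_iff₀ hT).1 hk, fun j N _ _ => ?_⟩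
  have : ∀ x : ℝ, ∀ i : ℕ, Q (x - j * (k * T) + i) = Q (x + i) := fun x i => by
    rw [← hQ.nat_mul (j * k) (x - j * (k * T) + i)]
    congr 1; push_cast; ring
  simp [this]

lemma volume_inter_le_of_setLIntegral_le {F : ℝ → ENNReal} {r M : ℝ} {s : Set ℝ} (hF : Measurable F)
    (hr : 0 < r) (h : ∫⁻ x in s, F x ≤ ENNReal.ofReal M) :
    volume ({x | ENNReal.ofReal r ≤ F x} ∩ s) ≤ ENNReal.ofReal (M / r) := by
  have h3 := (mul_meas_ge_le_lintegral (μ := volume.restrict s) hF (ENNReal.ofReal r)).trans h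
  rw [Measure.restrict_apply (measurableSet_le measurable_const hF)] at h3
  rw [ENNReal.ofReal_div_of_pos hr, ENNReal.le_div_iff_mul_le
    (Or.inl (by simpa using hr)) (Or.inl ENNReal.ofReal_ne_top), mul_comm]
  exact h3

lemma volume_prod_translate_lt_le {Q : ℝ → ℂ} (hQ : Continuous Q) {δ L B η t Λ : ℝ} (hδ : 0 < δ)
    (hL : 0 ≤ L) (hB : 0 ≤ B) (hη : 0 ≤ η) (hΛ : 0 < Λ) (hclose : ∀ x, ‖Q x - Q (x - t)‖ ≤ δ)
    (hsmall : ∀ y, volume ({x | ‖Q x‖ < δ} ∩ Set.Ico y (y + L)) ≤ ENNReal.ofReal η)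
    (hint : ∀ y, ∫⁻ x in Set.Ico y (y + L), ENNReal.ofReal (δ / max δ ‖Q x‖) ≤ ENNReal.ofReal B)
    {N p : ℕ} (hN : N ≤ p * L) (A : ℝ) :
    volume {x | x ∈ Set.Ico A (A + 1) ∧ Real.exp Λ * ∏ i ∈ Finset.range N, ‖Q (x - t + i)‖ <
      ∏ i ∈ Finset.range N, ‖Q (x + i)‖} ≤ ENNReal.ofReal (p * η + p * B / Λ) := by
  set s : Set ℝ := {x | ‖Q x‖ < δ}
  have hsm : MeasurableSet s := measurableSet_lt hQ.norm.measurable measurable_const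
  have hs1 : Measurable (s.indicator (1 : ℝ → ENNReal)) := measurable_one.indicator hsm
  have hWm : Measurable fun x => ENNReal.ofReal (δ / max δ ‖Q x‖) :=
    (continuous_const.div (continuous_const.max hQ.norm) fun x =>
      (lt_max_of_lt_left hδ).ne').measurable.ennreal_ofReal
  have key₁ := setLIntegral_sum_translate_le hs1 hL (fun y => by
    rw [lintegral_indicator_one hsm, Measure.restrict_apply hsm]; exact hsmall y) hN A t
  have key₂ := setLIntegral_sum_translate_le hWm hL hint hN A t
  have hcast : ∀ {r : ℝ}, 0 ≤ r → (p : ENNReal) * ENNReal.ofReal r = ENNReal.ofReal (p * r) :=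
    fun _ => by rw [← ENNReal.ofReal_natCast, ← ENNReal.ofReal_mul p.cast_nonneg]
  rw [hcast hη] at key₁
  rw [hcast hB] at key₂
  have hb₁ := volume_inter_le_of_setLIntegral_le (by fun_prop) one_pos key₁
  have hb₂ := volume_inter_le_of_setLIntegral_le (by fun_prop) hΛ key₂
  refine (measure_mono (t := _ ∪ _) ?_).trans ((measure_union_le _ _).trans
    ((add_le_add hb₁ hb₂).trans_eq ?_))
  · rintro x ⟨hxI, hx⟩
    by_contra hcon
    rw [Set.mem_union, not_or] at hcon
    obtain ⟨hc₁, hc₂⟩ := hcon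
    have hu : ∀ i < N, δ ≤ ‖Q (x - t + i)‖ := by
      intro i hi
      by_contra hlt
      refine hc₁ ⟨?_, hxI⟩
      have hmem : x - t + i ∈ s := not_le.1 hlt
      calc ENNReal.ofReal 1 = s.indicator 1 (x - t + i) := by
            rw [Set.indicator_of_mem hmem, ENNReal.ofReal_one, Pi.one_apply]
        _ ≤ _ := Finset.single_le_sum
          (f := fun i : ℕ => s.indicator (1 : ℝ → ENNReal) (x - t + i))
          (fun _ _ => zero_le) (Finset.mem_range.2 hi)
    have hprod := prod_norm_le_exp (N := N) hδ (u := fun i => Q (x - t + i))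
      (v := fun i => Q (x + i)) (fun i => by
        rw [show x - t + i = x + i - t by ring]; exact hclose (x + i)) hu
    refine absurd (hprod.trans (mul_le_mul_of_nonneg_right (Real.exp_le_exp.2 ?_)
      (Finset.prod_nonneg fun _ _ => norm_nonneg _))) (not_le.2 hx)
    by_contra hlt
    refine hc₂ ⟨?_, hxI⟩
    rw [Set.mem_ofPred_eq, ← ENNReal.ofReal_sum_of_nonneg fun k _ => by positivity]
    exact ENNReal.ofReal_le_ofReal (not_le.1 hlt).le
  · rw [div_one, ← ENNReal.ofReal_add (by positivity) (by positivity)]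

lemma hasAlmostPeriods_trinomial (a : ℂ) {b c : ℂ} (hb : b ≠ 0) (hc : c ≠ 0) {α β σ : ℝ}
    (hβ : β ≠ 0) (hαβ : α ≠ β) (hσ : |α| * σ = 1) {γ D : ℝ} (hγ : 1 < γ) (hD : 0 < D)
    (hfreq : ∃ᶠ n : ℕ in atTop, ∃ m : ℤ, IsCoprime m n ∧
      |n * (β * σ) - m| ≤ D * (n : ℝ) ^ (-γ)) :
    HasAlmostPeriods (trinomial a b c α β) := by
  have hσ0 : 0 < σ := by
    by_contra h
    nlinarith [abs_nonneg α]
  have hc' : 0 < ‖c‖ := norm_pos_iff.2 hc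
  intro A J κ hκ
  set D' := 2 * Real.pi * ‖c‖ * (J + 1) * D with hD'
  have hD'0 : 0 < D' := by have := Real.pi_pos; positivity
  obtain ⟨S, hS0, hS⟩ := exists_natCast_mul_rpow_sum_le hγ
  set C := 2 + 8 / ‖c‖ * (D' * S) with hC
  have hC0 : 0 < C := by positivity
  set Λ := 2 * (J + 1) * σ * C / κ with hΛ
  have hΛ0 : 0 < Λ := by positivity
  set η := κ / (2 * (J + 1)) with hη
  have hη0 : 0 < η := by positivity
  obtain ⟨ζ, hζ0, hζ⟩ := exists_volume_small_trinomial_le a (c := c) hb hβ hαβ hσ hη0 hC0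
  refine ⟨Real.exp Λ, fun N₀ => ?_⟩
  have hlim : Tendsto (fun n : ℕ => (n : ℝ) * (n : ℝ) ^ (-γ)) atTop (nhds 0) := by
    refine ((tendsto_rpow_neg_atTop (sub_pos.2 hγ)).comp tendsto_natCast_atTop_atTop).congr'
      (.of_forall fun n => ?_)
    beta_reduce
    rw [← Real.rpow_one_add' n.cast_nonneg (by linarith)]
    simp only [Function.comp_apply]; congr 1; ring
  have hev := (((hlim.const_mul D').eventually_le_const (by rw [mul_zero]; exact hζ0)).and
    ((hlim.const_mul D).eventually_le_const (u := 1 / 4) (by norm_num))).and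
    ((eventually_gt_atTop 0).and ((tendsto_natCast_atTop_atTop (R := ℝ)).eventually_ge_atTop
      ((N₀ + 1) / σ)))
  obtain ⟨n, ⟨m, hmn, hm⟩, ⟨h1, h2⟩, hn, hnN⟩ := (hfreq.and_eventually hev).exists
  have hn' : (0 : ℝ) < n := by exact_mod_cast hn
  rw [div_le_iff₀ hσ0] at hnN
  have hT1 : 1 ≤ n * σ := by have := N₀.cast_nonneg (α := ℝ); linarith
  set δ := D' * (n : ℝ) ^ (-γ) with hδ
  have hδ0 : 0 < δ := by positivity
  have hsum : ∀ x, ∑ k ∈ Finset.range n, δ / max δ ‖trinomial a b c α β (x + k * σ)‖ ≤ C := by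
    intro x
    refine (sum_div_max_trinomial_le hn hmn hσ ?_ hδ0 a b hc x).trans ?_
    · refine hm.trans ?_
      rw [le_div_iff₀ (by positivity)]
      linarith
    · rw [hC, mul_assoc (8 / ‖c‖)]
      have h3 := mul_le_mul_of_nonneg_left (mul_le_mul_of_nonneg_left (hS n hn) hD'0.le)
        (show 0 ≤ 8 / ‖c‖ by positivity)
      rw [hδ]
      linarith
  have hsmall := hζ n δ hn hδ0 (by rw [hδ]; linarith) hsum
  set Q := trinomial a b c α β with hQ
  have hQc : Continuous Q := continuous_trinomial _ _ _ _ _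
  refine ⟨n * σ, by linarith, fun j N hj hN => ?_⟩
  have hjJ : (j : ℝ) ≤ J := by exact_mod_cast hj
  have hNp : (N : ℝ) ≤ (J + 1 : ℕ) * (n * σ) := by
    push_cast; nlinarith
  have hclose : ∀ x, ‖Q x - Q (x - j * (n * σ))‖ ≤ δ := by
    intro x
    have h3 := e_mul_add_period hσ x (-(j * n))
    have h4 : x - j * (n * σ) = x + ((-(j * n) : ℤ) : ℝ) * σ := by push_cast; ring
    have h5 : Q x - Q (x - j * (n * σ)) =
        c * (e (β * x) - e (β * x - j * (n * (β * σ) - m))) := by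
      have h6 : e (β * (x - j * (n * σ))) = e (β * x - j * (n * (β * σ) - m)) := by
        rw [← e_add_int (β * (x - j * (n * σ))) (j * m)]
        congr 1; push_cast; ring
      simp only [hQ, trinomial]
      rw [h6, h4, h3]; ring
    rw [h5, norm_mul]
    have h6 := norm_e_sub_e_le (β * x) (β * x - j * (n * (β * σ) - m))
    rw [sub_sub_cancel, abs_mul, Nat.abs_cast] at h6
    calc ‖c‖ * ‖e (β * x) - e (β * x - j * (n * (β * σ) - m))‖
        ≤ ‖c‖ * (2 * Real.pi * ((J + 1) * (D * (n : ℝ) ^ (-γ)))) := by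
          refine mul_le_mul_of_nonneg_left (h6.trans ?_) hc'.le
          have := Real.pi_pos
          gcongr
          linarith
      _ = δ := by rw [hδ, hD']; ring
  refine (volume_prod_translate_lt_le hQc hδ0 (by positivity) (by positivity : 0 ≤ σ * C) hη0.le hΛ0
    hclose hsmall (fun y => ?_) hNp A).trans_eq ?_
  · have hWm : Measurable fun x => ENNReal.ofReal (δ / max δ ‖Q x‖) :=
      (continuous_const.div (continuous_const.max hQc.norm) fun x =>
        (lt_max_of_lt_left hδ0).ne').measurable.ennreal_ofReal
    rw [← setLIntegral_Ico_sum hWm hσ0.le]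
    refine (lintegral_mono (g := fun _ => ENNReal.ofReal C) fun x => ?_).trans_eq ?_
    · rw [← ENNReal.ofReal_sum_of_nonneg fun k _ => by positivity]
      exact ENNReal.ofReal_le_ofReal (hsum x)
    · rw [setLIntegral_const, Real.volume_Ico, ← ENNReal.ofReal_mul hC0.le]
      congr 1; ring
  · congr 1
    rw [hη, hΛ]; push_cast; field_simp; ring

lemma exists_lt_volume_inter_translate {E : Set ℝ} (hE : MeasurableSet E) (h0 : volume E ≠ 0) :
    ∃ κ > 0, ∃ r > 0, ∀ s : ℝ, |s| < r →
      ENNReal.ofReal κ < volume (E ∩ (fun x => x + s) ⁻¹' E) := by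
  obtain ⟨K, hKE, hK, hKpos⟩ := hE.exists_lt_isCompact (pos_iff_ne_zero.2 h0)
  have hKtop : volume K ≠ ⊤ := hK.measure_lt_top.ne
  set v := (volume K).toReal
  have hv0 : 0 < v := ENNReal.toReal_pos hKpos.ne' hKtop
  have hvK : volume K = ENNReal.ofReal v := (ENNReal.ofReal_toReal hKtop).symm
  obtain ⟨U, hKU, hU, hUlt⟩ := K.exists_isOpen_lt_of_lt (ENNReal.ofReal (3 / 2 * v))
    (by rw [hvK, ENNReal.ofReal_lt_ofReal_iff (by positivity)]; linarith)
  obtain ⟨r, hr, hrU⟩ := hK.exists_thickening_subset_open hU hKU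
  refine ⟨v / 4, by positivity, r, hr, fun s hs => ?_⟩
  have hpre : volume ((fun x => x + s) ⁻¹' K) = volume K := measure_preimage_add_right _ _ _
  have hpreU : (fun x => x + s) ⁻¹' K ⊆ U := fun x hx => hrU <|
    Metric.mem_thickening_iff.2 ⟨x + s, hx, by simpa [Real.dist_eq] using hs⟩
  have hKm : MeasurableSet ((fun x => x + s) ⁻¹' K) :=
    (measurable_id.add_const s) hK.measurableSet
  have h1 := measure_union_add_inter (μ := volume) K hKm
  rw [hpre, hvK, ← ENNReal.ofReal_add hv0.le hv0.le] at h1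
  have h2 : volume (K ∪ (fun x => x + s) ⁻¹' K) ≤ ENNReal.ofReal (3 / 2 * v) :=
    (measure_mono (Set.union_subset hKU hpreU)).trans hUlt.le
  refine lt_of_lt_of_le ?_ (measure_mono (μ := volume)
    (Set.inter_subset_inter hKE (Set.preimage_mono hKE)))
  by_contra hcon
  have h3 := (add_le_add h2 (not_lt.1 hcon)).trans_eq
    (ENNReal.ofReal_add (by positivity) (by positivity)).symm
  rw [h1, ENNReal.ofReal_le_ofReal_iff (by positivity)] at h3
  linarith

lemma ae_forall_add_int {p : ℝ → Prop} (hp : ∀ᵐ x, p x) : ∀ᵐ x : ℝ, ∀ z : ℤ, p (x + z) :=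
  ae_all_iff.2 fun z =>
    (measurePreserving_add_right (volume : Measure ℝ) (z : ℝ)).quasiMeasurePreserving.ae hp

lemma eq_prod_mul {f Q : ℝ → ℂ} {x : ℝ} (N : ℕ)
    (h : ∀ i < N, f (x + i) = Q (x + i) * f (x + i + 1)) :
    f x = (∏ i ∈ Finset.range N, Q (x + i)) * f (x + N) := by
  induction N with
  | zero => simp
  | succ N ih =>
    rw [ih fun i hi => h i (by omega), Finset.prod_range_succ, h N (by omega), mul_assoc]
    congr 3; push_cast; ring

lemma eventually_volume_large_le {A : ℤ} {g : ℕ → ℝ → ℂ} (hg : ∀ n, Measurable (g n))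
    (hlim : ∀ᵐ x : ℝ, Tendsto (fun n => g n x) atTop (nhds 0)) {ε κ : ℝ} (hε : 0 < ε)
    (hκ : 0 < κ) :
    ∀ᶠ n in atTop, volume ({x | ε ≤ ‖g n x‖} ∩ Set.Ico (A : ℝ) (A + 1)) ≤ ENNReal.ofReal κ := by
  have : IsFiniteMeasure (volume.restrict (Set.Ico (A : ℝ) (A + 1))) := ⟨by simp⟩
  have h1 := tendstoInMeasure_of_tendsto_ae (μ := volume.restrict (Set.Ico (A : ℝ) (A + 1)))
    (g := fun _ => 0) (fun n => (hg n).aestronglyMeasurable) (ae_restrict_of_ae hlim)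
  filter_upwards [(h1 (ENNReal.ofReal ε) (by simpa using hε)).eventually_le_const
    (u := ENNReal.ofReal κ) (by simpa using hκ)] with n hn
  rw [← Measure.restrict_apply (measurableSet_le measurable_const (hg n).norm)]
  refine (measure_mono fun x hx => ?_).trans hn
  rw [Set.mem_ofPred_eq, edist_zero_right, ← ofReal_norm]
  exact ENNReal.ofReal_le_ofReal hx

/-- A solution of `f x = Q x * f (x + 1)` with minimal decay vanishes if `Q` has almost periods:
the products of `Q` are large forwards and small backwards. -/
lemma ae_eq_zero_of_hasAlmostPeriods {f Q : ℝ → ℂ} (hf : Measurable f)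
    (heq : ∀ᵐ x, f x = Q x * f (x + 1))
    (hdecay : ∀ᵐ x : ℝ, Tendsto (fun n : ℤ => f (x + n)) atTop (nhds 0) ∧
      Tendsto (fun n : ℤ => f (x + n)) atBot (nhds 0))
    (hQ : HasAlmostPeriods Q) : ∀ᵐ x, f x = 0 := by
  by_contra hne
  obtain ⟨A, k, hAk⟩ : ∃ (A : ℤ) (k : ℕ),
      volume ({x | 1 / ((k : ℝ) + 1) ≤ ‖f x‖} ∩ Set.Ico (A : ℝ) (A + 1)) ≠ 0 := by
    by_contra! h
    refine hne (measure_mono_null (fun x hx => ?_)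
      (measure_iUnion_null fun A => measure_iUnion_null (h A)))
    obtain ⟨k, hk⟩ := exists_nat_one_div_lt (norm_pos_iff.2 hx)
    exact Set.mem_iUnion.2 ⟨⌊x⌋, Set.mem_iUnion.2
      ⟨k, hk.le, Int.floor_le x, Int.lt_floor_add_one x⟩⟩
  set a := 1 / ((k : ℝ) + 1)
  have ha0 : 0 < a := by positivity
  set I := Set.Ico (A : ℝ) (A + 1)
  set E := {x | a ≤ ‖f x‖} ∩ I
  have hEm : MeasurableSet E :=
    (measurableSet_le measurable_const hf.norm).inter measurableSet_Ico
  obtain ⟨κ, hκ, r, hr, htr⟩ := exists_lt_volume_inter_translate hEm hAk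
  have hκ3 : 0 < κ / 3 := by positivity
  obtain ⟨J, hJ⟩ := exists_nat_one_div_lt hr
  obtain ⟨R, hR⟩ := hQ A (J + 1) (κ / 3) hκ3
  set R' := max R 1
  have hR'0 : 0 < R' := lt_max_of_lt_right one_pos
  set ε := a / (2 * R') with hε
  have hε0 : 0 < ε := by positivity
  have hεa : R' * (ε * ε) < a * a := by
    have h1 : R' * ε = a / 2 := by rw [hε]; field_simp
    have h2 : ε ≤ a / 2 := by
      rw [← h1]; exact le_mul_of_one_le_left hε0.le (le_max_right _ _)
    rw [← mul_assoc, h1]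
    nlinarith
  have hev₁ := eventually_volume_large_le (A := A) (g := fun N x => f (x + N))
    (fun N => by fun_prop) (hdecay.mono fun x hx => by
      simpa [Function.comp_def] using hx.1.comp tendsto_natCast_atTop_atTop) hε0 hκ3
  have hev₂ := eventually_volume_large_le (A := A) (g := fun N x => f (x - N))
    (fun N => by fun_prop) (hdecay.mono fun x hx => by
      have := hx.2.comp (tendsto_neg_atTop_atBot.comp tendsto_natCast_atTop_atTop)
      simpa [Function.comp_def, sub_eq_add_neg] using this) hε0 hκ3
  obtain ⟨N₁, hN₁⟩ := eventually_atTop.1 (hev₁.and hev₂)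
  obtain ⟨T, hT, hTR⟩ := hR (N₁ + 1)
  push_cast at hT
  obtain ⟨j, hj0, hjJ, hj⟩ := Real.exists_nat_abs_mul_sub_round_le T (Nat.succ_pos J)
  have hjr : |j * T - round (j * T)| < r := by
    refine hj.trans_lt (lt_of_le_of_lt ?_ hJ)
    push_cast
    gcongr
    linarith
  have hj1 : (1 : ℝ) ≤ j := by exact_mod_cast hj0
  have hhalf := abs_le.1 (abs_sub_round (j * T))
  have hTj : T ≤ j * T := by
    have : (0 : ℝ) ≤ N₁ := N₁.cast_nonneg
    nlinarith
  have hNge : (N₁ : ℤ) ≤ round (j * T) := by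
    have : (N₁ : ℝ) ≤ (round (j * T) : ℝ) := by linarith [hhalf.2]
    exact_mod_cast this
  obtain ⟨N, hN⟩ : ∃ N : ℕ, (N : ℤ) = round (j * T) :=
    ⟨(round (j * T)).toNat, Int.toNat_of_nonneg (by omega)⟩
  have hNR : (round (j * T) : ℝ) = N := by rw [← hN]; simp
  rw [hNR] at hjr hhalf
  obtain ⟨hB₁, hB₂⟩ := hN₁ N (by omega)
  have hB₃ := hTR j N hjJ (by linarith [hhalf.1])
  set s := N - j * T with hs
  have hsr : |s| < r := by rw [hs, abs_sub_comm]; exact hjr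
  have hmp := measurePreserving_add_right (volume : Measure ℝ) s
  have horb := ae_forall_add_int heq
  have horb' := hmp.quasiMeasurePreserving.ae horb
  set B₁ := {x | ε ≤ ‖f (x + N)‖} ∩ I
  set B₂ := {x | ε ≤ ‖f (x - N)‖} ∩ I
  set B₃ := {x | x ∈ I ∧ R * ∏ i ∈ Finset.range N, ‖Q (x - j * T + i)‖ <
    ∏ i ∈ Finset.range N, ‖Q (x + i)‖}
  have hB₂' : volume ((fun x => x + s) ⁻¹' B₂) ≤ ENNReal.ofReal (κ / 3) := by
    rwa [measure_preimage_add_right]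
  refine absurd (htr s hsr) (not_lt.2 ?_)
  have hbound : volume (B₁ ∪ (fun x => x + s) ⁻¹' B₂ ∪ B₃) ≤ ENNReal.ofReal κ := by
    refine (measure_union_le _ _).trans ((add_le_add (measure_union_le _ _) le_rfl).trans
      ((add_le_add (add_le_add hB₁ hB₂') hB₃).trans_eq ?_))
    rw [← ENNReal.ofReal_add hκ3.le hκ3.le, ← ENNReal.ofReal_add (by positivity) hκ3.le]
    congr 1; ring
  refine (measure_mono_ae ?_).trans hbound
  filter_upwards [horb, horb'] with x hx hx' hxE
  obtain ⟨⟨hxa, hxI⟩, ⟨hya, hyI⟩⟩ := hxE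
  by_contra hcon
  have hx₁ : ‖f (x + N)‖ < ε := by
    by_contra h; exact hcon (Or.inl (Or.inl ⟨not_lt.1 h, hxI⟩))
  have hx₂ : ‖f (x + s - N)‖ < ε := by
    by_contra h; exact hcon (Or.inl (Or.inr ⟨not_lt.1 h, hyI⟩))
  have hx₃ : ∏ i ∈ Finset.range N, ‖Q (x + i)‖ ≤
      R * ∏ i ∈ Finset.range N, ‖Q (x - j * T + i)‖ := by
    by_contra h; exact hcon (Or.inr ⟨hxI, not_le.1 h⟩)
  have e₁ := congrArg norm (eq_prod_mul (f := f) (Q := Q) (x := x) N fun i _ => by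
    simpa using hx i)
  have e₂ := congrArg norm (eq_prod_mul (f := f) (Q := Q) (x := x - j * T) N fun i _ => by
    have := hx' (i - N)
    have h3 : x + s + ((i - N : ℤ) : ℝ) = x - j * T + i := by rw [hs]; push_cast; ring
    rwa [h3] at this)
  have h4 : x + s - N = x - j * T := by rw [hs]; ring
  have h5 : x - j * T + N = x + s := by rw [hs]; ring
  rw [h4] at hx₂
  rw [h5] at e₂
  rw [norm_mul, norm_prod] at e₁ e₂
  simp only [Set.mem_ofPred_eq] at hxa hya
  set P₁ := ∏ i ∈ Finset.range N, ‖Q (x + i)‖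
  set P₂ := ∏ i ∈ Finset.range N, ‖Q (x - j * T + i)‖
  have hP₂0 : 0 ≤ P₂ := Finset.prod_nonneg fun _ _ => norm_nonneg _
  have hfin : a * a ≤ R' * (ε * ε) := calc
    a * a ≤ ‖f x‖ * ‖f (x + s)‖ := by gcongr
    _ = P₁ * ‖f (x + N)‖ * ‖f (x + s)‖ := by rw [e₁]
    _ ≤ (R' * P₂) * ‖f (x + N)‖ * ‖f (x + s)‖ := by
      gcongr
      exact hx₃.trans (mul_le_mul_of_nonneg_right (le_max_left _ _) hP₂0)
    _ = R' * (‖f (x - j * T)‖ * ‖f (x + N)‖) := by rw [e₂]; ring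
    _ ≤ R' * (ε * ε) := by gcongr
  linarith

lemma frequently_isCoprime_of_irrational {ρ : ℝ} (hρ : Irrational ρ) {γ D : ℝ} (hγ : 0 < γ)
    (hD : 0 < D) (h : ∃ᶠ n : ℕ in atTop, ∃ m : ℤ, |n * ρ - m| ≤ D * (n : ℝ) ^ (-γ)) :
    ∃ᶠ n : ℕ in atTop, ∃ m : ℤ, IsCoprime m n ∧ |n * ρ - m| ≤ D * (n : ℝ) ^ (-γ) := by
  rw [frequently_atTop]
  intro B
  have hlim : Tendsto (fun n : ℕ => D * (n : ℝ) ^ (-γ)) atTop (nhds 0) := by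
    simpa using ((tendsto_rpow_neg_atTop hγ).comp tendsto_natCast_atTop_atTop).const_mul D
  have hev : ∀ᶠ n : ℕ in atTop, ∀ k ∈ Finset.Ico 1 B,
      D * (n : ℝ) ^ (-γ) < |k * ρ - round (k * ρ)| := by
    rw [eventually_all_finset]
    intro k hk
    refine hlim.eventually_lt_const (abs_pos.2 (sub_ne_zero.2 ?_))
    exact (hρ.natCast_mul (Nat.one_le_iff_ne_zero.1 (Finset.mem_Ico.1 hk).1)).ne_int _
  obtain ⟨n, ⟨m, hm⟩, hn, hn0⟩ := (h.and_eventually (hev.and (eventually_gt_atTop 0))).exists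
  have hg : 0 < Int.gcd m n := Int.gcd_pos_of_ne_zero_right _ (by exact_mod_cast hn0.ne')
  obtain ⟨g, m', n', hg0, hcop, hm', hn'⟩ := Int.exists_gcd_one' hg
  have hn'0 : 0 < n' := by
    have : 0 < n' * (g : ℤ) := hn' ▸ (by exact_mod_cast hn0)
    exact pos_of_mul_pos_left this (by positivity)
  lift n' to ℕ using hn'0.le
  have hn'0 : 0 < n' := by exact_mod_cast hn'0
  have hn'n : n = n' * g := by exact_mod_cast hn'
  have hg1 : (1 : ℝ) ≤ g := by exact_mod_cast hg0
  have hle : |n' * ρ - m'| ≤ D * (n : ℝ) ^ (-γ) := by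
    refine le_trans ?_ hm
    have : n * ρ - m = (n' * ρ - m') * g := by
      rw [hn'n, hm']; push_cast; ring
    rw [this, abs_mul, Nat.abs_cast]
    exact le_mul_of_one_le_right (abs_nonneg _) hg1
  refine ⟨n', ?_, m', Int.isCoprime_iff_gcd_eq_one.2 hcop, hle.trans ?_⟩
  · by_contra hB
    have := hn n' (Finset.mem_Ico.2 ⟨hn'0, not_le.1 hB⟩)
    exact absurd (this.trans_le (round_le _ m')) (not_lt.2 hle)
  · refine mul_le_mul_of_nonneg_left (Real.rpow_le_rpow_of_nonpos (by exact_mod_cast hn'0) ?_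
      (by linarith)) hD.le
    rw [hn'n]; push_cast
    exact le_mul_of_one_le_right (by positivity) hg1

lemma hasAlmostPeriods_trinomial_of_nint_le (a b c : ℂ) {α β : ℝ} (hα : α ≠ 0) (hβ : β ≠ 0)
    (hαβ : α ≠ β) {γ C : ℝ} (hγ : 1 < γ)
    (hfreq : ∃ᶠ n : ℕ in atTop, (n : ℝ) ^ γ * nint (n * (β / α)) ≤ C) :
    HasAlmostPeriods (trinomial a b c α β) := by
  have hper : ∀ {α : ℝ}, α ≠ 0 → |α| * |α|⁻¹ = 1 := fun h => mul_inv_cancel₀ (abs_ne_zero.2 h)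
  rcases eq_or_ne b 0 with rfl | hb
  · refine hasAlmostPeriods_of_periodic (inv_pos.2 (abs_pos.2 hβ)) fun x => ?_
    have := e_mul_add_period (hper hβ) x 1
    rw [Int.cast_one, one_mul] at this
    simp [trinomial, this]
  rcases eq_or_ne c 0 with rfl | hc
  · refine hasAlmostPeriods_of_periodic (inv_pos.2 (abs_pos.2 hα)) fun x => ?_
    have := e_mul_add_period (hper hα) x 1
    rw [Int.cast_one, one_mul] at this
    simp [trinomial, this]
  by_cases hirr : Irrational (β * |α|⁻¹)
  · refine hasAlmostPeriods_trinomial a hb hc hβ hαβ (hper hα) hγ (D := max C 1) (by positivity)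
      (frequently_isCoprime_of_irrational hirr (by linarith) (by positivity) ?_)
    refine (hfreq.and_eventually (eventually_gt_atTop 0)).mono fun n ⟨hn, hn0⟩ => ?_
    have hn0 : (0 : ℝ) < n := by exact_mod_cast hn0
    have h1 : nint (n * (β / α)) ≤ max C 1 * (n : ℝ) ^ (-γ) := by
      rw [Real.rpow_neg hn0.le, ← div_eq_mul_inv, le_div_iff₀ (by positivity), mul_comm]
      exact hn.trans (le_max_left _ _)
    rcases abs_choice α with h | h <;> rw [h]
    · exact ⟨round (n * (β / α)), h1⟩
    · refine ⟨-round (n * (β / α)), (le_of_eq ?_).trans h1⟩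
      rw [nint, ← abs_neg]
      congr 1; push_cast; rw [inv_neg]; ring
  · rw [Irrational, not_not] at hirr
    obtain ⟨q, hq⟩ := hirr
    have hq' : (q.den : ℝ) * (β * |α|⁻¹) = q.num := by
      rw [← hq, mul_comm]; exact_mod_cast q.mul_den_eq_num
    have hd : (0 : ℝ) < q.den := by exact_mod_cast q.den_pos
    refine hasAlmostPeriods_of_periodic (T := q.den * |α|⁻¹) (by positivity) fun x => ?_
    have h1 := e_mul_add_period (hper hα) x q.den
    rw [Int.cast_natCast] at h1
    have h2 : e (β * (x + q.den * |α|⁻¹)) = e (β * x) := by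
      rw [← e_add_int (β * x) q.num, ← hq']; congr 1; ring
    simp [trinomial, h1, h2]

lemma hasDerivAt_trinomial (a b c : ℂ) (α β x : ℝ) :
    HasDerivAt (trinomial a b c α β)
      (2 * Real.pi * Complex.I * trinomial 0 (b * α) (c * β) α β x) x := by
  refine ((((hasDerivAt_e_mul α x).const_mul b).const_add a).add
    ((hasDerivAt_e_mul β x).const_mul c)).congr_deriv ?_
  rw [trinomial]; ring

lemma trinomial_deriv_eq_zero {a b c : ℂ} {α β : ℝ} (h : ∀ x, trinomial a b c α β x = 0) (x : ℝ) :
    trinomial 0 (b * α) (c * β) α β x = 0 := by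
  have h1 := hasDerivAt_trinomial a b c α β x
  rw [show trinomial a b c α β = fun _ => 0 from funext h] at h1
  simpa [Real.pi_ne_zero] using h1.unique (hasDerivAt_const x 0)

lemma coeff_eq_zero_of_trinomial_eq_zero {a b c : ℂ} {α β : ℝ} (hα : α ≠ 0) (hβ : β ≠ 0)
    (hαβ : α ≠ β) (h : ∀ x, trinomial a b c α β x = 0) : a = 0 ∧ b = 0 ∧ c = 0 := by
  have h1 := trinomial_deriv_eq_zero h
  have h2 := trinomial_deriv_eq_zero h1 0
  have h0 := h 0
  have h1 := h1 0
  have he : e 0 = 1 := by simpa using e_int 0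
  simp only [trinomial, mul_zero, he, mul_one, zero_add] at h0 h1 h2
  have hα' : (α : ℂ) ≠ 0 := by exact_mod_cast hα
  have hβ' : (β : ℂ) ≠ 0 := by exact_mod_cast hβ
  have hαβ' : (α : ℂ) - β ≠ 0 := sub_ne_zero.2 (by exact_mod_cast hαβ)
  have hc : c = 0 := by
    have : c * (β * (α - β)) = 0 := by linear_combination (α : ℂ) * h1 - h2
    simpa [hβ', hαβ'] using this
  subst hc
  have hb : b = 0 := by simpa [hα'] using h1
  subst hb
  simpa using h0

lemma ae_trinomial_ne_zero {a b c : ℂ} {α β : ℝ} (hα : α ≠ 0) (hβ : β ≠ 0) (hαβ : α ≠ β)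
    (h : ¬(a = 0 ∧ b = 0 ∧ c = 0)) : ∀ᵐ x : ℝ, trinomial a b c α β x ≠ 0 := by
  obtain ⟨x, hx⟩ : ∃ x, trinomial a b c α β x ≠ 0 := by
    by_contra! hcon
    exact h (coeff_eq_zero_of_trinomial_eq_zero hα hβ hαβ hcon)
  have he : ∀ ω : ℝ, AnalyticOnNhd ℝ (fun x => e (ω * x)) Set.univ := fun ω x _ => by
    unfold e
    have h1 : AnalyticAt ℝ (fun x : ℝ => ((ω * x : ℝ) : ℂ)) x :=
      (Complex.ofRealCLM.analyticAt _).comp (analyticAt_const.mul analyticAt_id)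
    exact (analyticAt_cexp.restrictScalars (𝕜 := ℝ)).comp (analyticAt_const.mul h1)
  have hP : AnalyticOnNhd ℝ (trinomial a b c α β) Set.univ := fun x hx =>
    (analyticAt_const.add (analyticAt_const.mul (he α x hx))).add
      (analyticAt_const.mul (he β x hx))
  have h1 := ae_restrict_le_codiscreteWithin (μ := volume) MeasurableSet.univ
    (hP.preimage_zero_mem_codiscrete hx)
  rw [Measure.restrict_univ] at h1
  exact h1

/-- For the special (1,3) configuration `(0,0),(1,0),(1,α),(1,β)` with the Diophantine
condition `liminf n^γ min{‖nβ/α‖,‖nα/β‖} < ∞` for some `γ > 1`, no nontrivial measurable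
solution with minimal decay along integer translates exists. -/
theorem hrt_minimal_decay_special_one_three_diophantine
    (α β : ℝ) (hα : α ≠ 0) (hβ : β ≠ 0) (hαβ : α ≠ β)
    (hdio : ∃ γ : ℝ, 1 < γ ∧ ∃ c : ℝ, ∃ᶠ n : ℕ in atTop,
      (n : ℝ) ^ γ * min (nint ((n : ℝ) * (β / α))) (nint ((n : ℝ) * (α / β))) ≤ c)
    (f : ℝ → ℂ) (hf : Measurable f)
    (d : Fin 4 → ℂ) (hd : ∃ i, d i ≠ 0)
    (heq : ∀ᵐ x : ℝ, d 0 * f x + d 1 * f (x + 1) + d 2 * f (x + 1) * e (α * x)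
      + d 3 * f (x + 1) * e (β * x) = 0)
    (hdecay : ∀ᵐ x : ℝ, Tendsto (fun n : ℤ => f (x + n)) atTop (nhds 0) ∧
      Tendsto (fun n : ℤ => f (x + n)) atBot (nhds 0)) :
    ∀ᵐ x : ℝ, f x = 0 := by
  rcases eq_or_ne (d 0) 0 with hd0 | hd0
  · have hne : ¬(d 1 = 0 ∧ d 2 = 0 ∧ d 3 = 0) := fun ⟨h1, h2, h3⟩ => by
      obtain ⟨i, hi⟩ := hd
      fin_cases i <;> exact hi (by assumption)
    have hshift : ∀ᵐ x : ℝ, f (x + 1) = 0 := by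
      filter_upwards [heq, ae_trinomial_ne_zero hα hβ hαβ hne] with x hx hP
      refine (mul_eq_zero.1
        (?_ : trinomial (d 1) (d 2) (d 3) α β x * f (x + 1) = 0)).resolve_left hP
      rw [trinomial]; linear_combination hx - f x * hd0
    filter_upwards [ae_forall_add_int hshift] with x hx
    have := hx (-1)
    rwa [Int.cast_neg, Int.cast_one, neg_add_cancel_right] at this
  · refine ae_eq_zero_of_hasAlmostPeriods hf
      (Q := trinomial (-d 1 / d 0) (-d 2 / d 0) (-d 3 / d 0) α β) ?_ hdecay ?_
    · filter_upwards [heq] with x hx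
      rw [trinomial]
      generalize e (α * x) = u, e (β * x) = v at hx ⊢
      field_simp; linear_combination hx
    obtain ⟨γ, hγ, C, hC⟩ := hdio
    have hor : ∃ᶠ n : ℕ in atTop, (n : ℝ) ^ γ * nint (n * (β / α)) ≤ C ∨
        (n : ℝ) ^ γ * nint (n * (α / β)) ≤ C := by
      refine hC.mono fun n hn => ?_
      rcases min_choice (nint ((n : ℝ) * (β / α))) (nint ((n : ℝ) * (α / β))) with h | h <;>
        rw [h] at hn
      exacts [Or.inl hn, Or.inr hn]
    rcases frequently_or_distrib.1 hor with h | h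
    · exact hasAlmostPeriods_trinomial_of_nint_le _ _ _ hα hβ hαβ hγ h
    · convert hasAlmostPeriods_trinomial_of_nint_le (-d 1 / d 0) (-d 3 / d 0) (-d 2 / d 0) hβ hα
        hαβ.symm hγ h using 1
      funext x
      simp only [trinomial]; ring
end

section
/- Let C₀, C₁, C₂ ∈ ℂ be nonzero complex numbers. Then the set of real zeros in [0,1)² of the polynomial p(x,y) = C₀ + C₁e(x) + C₂e(y), i.e. {(x,y) ∈ [0,1)² : C₀ + C₁e^{2πix} + C₂e^{2πiy} = 0}, has at most two elements. -/
open MeasureTheory Filter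

theorem injOn_e : Set.InjOn e (Set.Ico (0 : ℝ) 1) := by
  intro x hx y hy h
  obtain ⟨n, hn⟩ := Complex.exp_eq_exp_iff_exists_int.mp h
  have hxy : (x : ℂ) = y + n :=
    mul_left_cancel₀ Complex.two_pi_I_ne_zero (by linear_combination hn)
  have hxy' : x = y + n := by exact_mod_cast hxy
  have hlt : (n : ℝ) < 1 := by linarith [hx.2, hy.1]
  have hgt : (-1 : ℝ) < n := by linarith [hx.1, hy.2]
  have hn0 : n = 0 := by
    have : n < 1 := by exact_mod_cast hlt
    have : -1 < n := by exact_mod_cast hgt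
    omega
  simpa [hn0] using hxy'

theorem e_mul_conj (x : ℝ) : e x * (starRingEnd ℂ) (e x) = 1 := by
  rw [e, ← Complex.exp_conj, ← Complex.exp_add]
  simp [Complex.conj_ofNat]

theorem encard_setOf_quadratic_eq_zero_le {K : Type*} [Field K] {a : K} (ha : a ≠ 0) (b c : K) :
    {u : K | a * u ^ 2 + b * u + c = 0}.encard ≤ 2 := by
  classical
  open Polynomial in
  let p : K[X] := C a * X ^ 2 + C b * X + C c
  have hdeg : p.natDegree = 2 := Polynomial.natDegree_quadratic ha
  have hp : p ≠ 0 := by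
    intro h
    simp [h] at hdeg
  calc {u : K | a * u ^ 2 + b * u + c = 0}.encard
      ≤ (p.roots.toFinset : Set K).encard := Set.encard_le_encard fun u hu => by
        simpa [hp, p] using hu
    _ ≤ 2 := by
        rw [Set.encard_coe_eq_coe_finsetCard]
        exact_mod_cast (p.roots.toFinset_card_le.trans p.card_roots').trans hdeg.le

/-- Eliminating the unimodular number `v` from `A + B * u + D * v = 0` leaves a quadratic equation
for the unimodular number `u`. -/
theorem quadratic_of_unimodular_zero {A B D u v : ℂ}
    (hu : u * (starRingEnd ℂ) u = 1) (hv : v * (starRingEnd ℂ) v = 1)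
    (h : A + B * u + D * v = 0) :
    (B * (starRingEnd ℂ) A) * u ^ 2 +
      (A * (starRingEnd ℂ) A + B * (starRingEnd ℂ) B - D * (starRingEnd ℂ) D) * u +
        A * (starRingEnd ℂ) B = 0 := by
  have hc := congrArg (starRingEnd ℂ) h
  simp only [map_add, map_mul, map_zero] at hc
  generalize (starRingEnd ℂ) A = A', (starRingEnd ℂ) B = B', (starRingEnd ℂ) D = D',
    (starRingEnd ℂ) u = u', (starRingEnd ℂ) v = v' at *
  linear_combination (A' * u + B' * u * u') * h - D * v * u * hc + D * D' * u * hv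
    - (A * B' + B * B' * u) * hu

/-- The polynomial `p(x,y) = C₀ + C₁ e(x) + C₂ e(y)` with nonzero coefficients has at most two
real zeros in `[0,1)²`. -/
theorem zeros_of_trig_polynomial_le_two
    (C₀ C₁ C₂ : ℂ) (h₀ : C₀ ≠ 0) (h₁ : C₁ ≠ 0) (h₂ : C₂ ≠ 0) :
    {z : ℝ × ℝ | z.1 ∈ Set.Ico (0 : ℝ) 1 ∧ z.2 ∈ Set.Ico (0 : ℝ) 1 ∧
      C₀ + C₁ * e z.1 + C₂ * e z.2 = 0}.encard ≤ 2 := by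
  have ha : C₁ * (starRingEnd ℂ) C₀ ≠ 0 := mul_ne_zero h₁ (by simpa using h₀)
  refine le_trans ?_ (encard_setOf_quadratic_eq_zero_le ha
    (C₀ * (starRingEnd ℂ) C₀ + C₁ * (starRingEnd ℂ) C₁ - C₂ * (starRingEnd ℂ) C₂)
    (C₀ * (starRingEnd ℂ) C₁))
  refine Set.encard_le_encard_of_injOn (f := fun z : ℝ × ℝ => e z.1) ?_ ?_
  · rintro z ⟨-, -, hz⟩
    exact quadratic_of_unimodular_zero (e_mul_conj z.1) (e_mul_conj z.2) hz
  · rintro z ⟨hz₁, hz₂, hz⟩ w ⟨hw₁, hw₂, hw⟩ (h : e z.1 = e w.1)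
    have h' : e z.2 = e w.2 :=
      mul_left_cancel₀ h₂ (by linear_combination hz - hw - C₁ * h)
    exact Prod.ext (injOn_e hz₁ hw₁ h) (injOn_e hz₂ hw₂ h')
end

section
/- For every δ > 0 there exists a constant C = C(δ) > 0 with the following property: for every integer N ≥ 2 and every choice of N (not necessarily distinct) real numbers x₁, x₂, …, x_N, there exists a measurable set E_{N,δ} ⊂ [0,1] with Lebesgue measure |E_{N,δ}| ≤ δ such that every x ∈ [0,1] \ E_{N,δ} satisfies: x − x_n is not an integer for all 1 ≤ n ≤ N, (1/N)·Σ_{n=1}^N 1/‖x − x_n‖ ≤ C·log N, and (1/N²)·Σ_{n=1}^N 1/‖x − x_n‖² ≤ C. -/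
open MeasureTheory Filter

theorem nint_eq_norm (t : ℝ) : nint t = ‖(t : UnitAddCircle)‖ :=
  (UnitAddCircle.norm_eq (x := t)).symm

theorem nint_nonneg (t : ℝ) : 0 ≤ nint t := abs_nonneg _

theorem continuous_nint : Continuous nint := by
  have h : nint = fun t : ℝ => ‖(t : UnitAddCircle)‖ := funext nint_eq_norm
  rw [h]
  exact continuous_norm.comp (AddCircle.continuous_mk' 1)

theorem nint_periodic : Function.Periodic nint 1 := fun t => by
  simp only [nint, round_add_one]
  push_cast
  congr 1
  ring

theorem nint_intCast (m : ℤ) : nint m = 0 := by simp [nint]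

theorem nint_eq_abs {t : ℝ} (h : |t| ≤ 1 / 2) : nint t = |t| := by
  rw [nint_eq_norm]
  exact (AddCircle.norm_coe_eq_abs_iff 1 one_ne_zero).2 (by rwa [abs_one])

/-- Functions of the distance to the nearest integer have translation-invariant integrals over a
period. -/
theorem integral_comp_nint_sub {φ : ℝ → ℝ} (hφ : Continuous φ) (a : ℝ) :
    ∫ y in (0 : ℝ)..1, φ (nint (y - a)) = 2 * ∫ t in (0 : ℝ)..(1 / 2), φ t := by
  have hper : Function.Periodic (fun t => φ (nint t)) 1 := fun t => by
    simp only [nint_periodic t]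
  have hint : ∀ u v : ℝ, IntervalIntegrable (fun t => φ (nint t)) volume u v := fun u v =>
    (hφ.comp continuous_nint).intervalIntegrable u v
  have hpos : ∫ t in (0 : ℝ)..(1 / 2), φ (nint t) = ∫ t in (0 : ℝ)..(1 / 2), φ t := by
    refine intervalIntegral.integral_congr fun t ht => ?_
    rw [Set.uIcc_of_le (by norm_num)] at ht
    simp only [nint_eq_abs (abs_le.2 ⟨by linarith [ht.1], ht.2⟩), abs_of_nonneg ht.1]
  have hneg : ∫ t in (-(1 / 2) : ℝ)..0, φ (nint t) = ∫ t in (0 : ℝ)..(1 / 2), φ t := by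
    have h := intervalIntegral.integral_comp_neg (a := 0) (b := 1 / 2) fun t => φ (nint t)
    rw [neg_zero] at h
    rw [← h]
    refine intervalIntegral.integral_congr fun t ht => ?_
    rw [Set.uIcc_of_le (by norm_num)] at ht
    have ht' : |-t| ≤ 1 / 2 := by rw [abs_neg, abs_of_nonneg ht.1]; exact ht.2
    simp only [nint_eq_abs ht', abs_neg, abs_of_nonneg ht.1]
  rw [intervalIntegral.integral_comp_sub_right (fun t => φ (nint t)) a]
  have h := hper.intervalIntegral_add_eq (0 - a) (-(1 / 2))
  rw [show 0 - a + 1 = 1 - a by ring, show -(1 / 2) + 1 = (1 / 2 : ℝ) by norm_num] at h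
  rw [h, ← intervalIntegral.integral_add_adjacent_intervals (hint _ 0) (hint 0 _), hpos, hneg]
  ring

theorem continuous_inv_abs_add_pow {r : ℝ} (hr : 0 < r) (k : ℕ) :
    Continuous fun t : ℝ => ((|t| + r) ^ k)⁻¹ :=
  Continuous.inv₀ (by fun_prop) fun t => by positivity

theorem integral_inv_abs_add {r : ℝ} (hr : 0 < r) :
    ∫ t in (0 : ℝ)..(1 / 2), ((|t| + r) ^ 1)⁻¹ = Real.log (1 + 1 / (2 * r)) := by
  rw [intervalIntegral.integral_eq_sub_of_hasDerivAt (f := fun t => Real.log (t + r))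
    (fun t ht => ?_) ((continuous_inv_abs_add_pow hr 1).intervalIntegrable _ _),
    ← Real.log_div (by positivity) (by positivity)]
  · congr 1
    field_simp
    ring
  · rw [Set.uIcc_of_le (by norm_num)] at ht
    have h := ((hasDerivAt_id t).add_const r).log (by simp only [id]; linarith [ht.1])
    simpa [abs_of_nonneg ht.1] using h

theorem integral_inv_abs_add_sq_le {r : ℝ} (hr : 0 < r) :
    ∫ t in (0 : ℝ)..(1 / 2), ((|t| + r) ^ 2)⁻¹ ≤ 1 / r := by
  rw [intervalIntegral.integral_eq_sub_of_hasDerivAt (f := fun t => -(t + r)⁻¹)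
    (fun t ht => ?_) ((continuous_inv_abs_add_pow hr 2).intervalIntegrable _ _)]
  · have h : 0 < (1 / 2 + r)⁻¹ := by positivity
    rw [zero_add, one_div r]
    linarith
  · rw [Set.uIcc_of_le (by norm_num)] at ht
    have h := (((hasDerivAt_id t).add_const r).inv (by simp only [id]; linarith [ht.1])).neg
    have hval : ((|t| + r) ^ 2)⁻¹ = -(-1 / (id t + r) ^ 2) := by
      rw [abs_of_nonneg ht.1, neg_div, neg_neg, one_div, id]
    rw [hval]
    exact h

/-- `∑ₙ (‖y - xₙ‖ + r)⁻ᵏ`, a bounded substitute for `∑ₙ ‖y - xₙ‖⁻ᵏ`. -/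
noncomputable def regularizedSum (N : ℕ) (x : ℕ → ℝ) (r : ℝ) (k : ℕ) (y : ℝ) : ℝ :=
  ∑ n ∈ Finset.range N, ((|nint (y - x n)| + r) ^ k)⁻¹

theorem continuous_regularizedSum (N : ℕ) (x : ℕ → ℝ) {r : ℝ} (hr : 0 < r) (k : ℕ) :
    Continuous (regularizedSum N x r k) :=
  continuous_finsetSum _ fun _ _ => (continuous_inv_abs_add_pow hr k).comp
    (continuous_nint.comp (continuous_id.sub continuous_const))

theorem regularizedSum_nonneg (N : ℕ) (x : ℕ → ℝ) {r : ℝ} (hr : 0 < r) (k : ℕ) (y : ℝ) :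
    0 ≤ regularizedSum N x r k y :=
  Finset.sum_nonneg fun n _ => by positivity

theorem integral_regularizedSum (N : ℕ) (x : ℕ → ℝ) {r : ℝ} (hr : 0 < r) (k : ℕ) :
    ∫ y in (0 : ℝ)..1, regularizedSum N x r k y =
      N * (2 * ∫ t in (0 : ℝ)..(1 / 2), ((|t| + r) ^ k)⁻¹) := by
  have hc := continuous_inv_abs_add_pow hr k
  have hint : ∀ n ∈ Finset.range N, IntervalIntegrable
      (fun y => ((|nint (y - x n)| + r) ^ k)⁻¹) volume 0 1 := fun n _ =>
    (hc.comp (continuous_nint.comp (continuous_id.sub continuous_const))).intervalIntegrable _ _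
  simp only [regularizedSum]
  rw [intervalIntegral.integral_finsetSum hint,
    Finset.sum_congr rfl fun n _ => integral_comp_nint_sub hc (x n), Finset.sum_const,
    Finset.card_range, nsmul_eq_mul]

theorem inv_nint_pow_le {r t : ℝ} (hr : 0 < r) (h : r ≤ nint t) (k : ℕ) :
    1 / nint t ^ k ≤ 2 ^ k * ((|nint t| + r) ^ k)⁻¹ := by
  have ht : 0 < nint t := hr.trans_le h
  rw [abs_of_pos ht, ← div_eq_mul_inv, div_le_div_iff₀ (by positivity) (by positivity), one_mul,
    ← mul_pow]
  gcongr
  linarith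

theorem sum_inv_nint_pow_le {N : ℕ} {x : ℕ → ℝ} {r y : ℝ} (hr : 0 < r)
    (h : ∀ n ∈ Finset.range N, r ≤ nint (y - x n)) (k : ℕ) :
    ∑ n ∈ Finset.range N, 1 / nint (y - x n) ^ k ≤ 2 ^ k * regularizedSum N x r k y := by
  rw [regularizedSum, Finset.mul_sum]
  exact Finset.sum_le_sum fun n hn => inv_nint_pow_le hr (h n hn) k

theorem lt_nint_of_regularizedSum_lt {N : ℕ} {x : ℕ → ℝ} {r y : ℝ} (hr : 0 < r)
    (h : regularizedSum N x r 2 y < 1 / (4 * r ^ 2)) {n : ℕ} (hn : n ∈ Finset.range N) :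
    r < nint (y - x n) := by
  by_contra! hle
  have h0 := nint_nonneg (y - x n)
  have hterm : ((|nint (y - x n)| + r) ^ 2)⁻¹ ≤ regularizedSum N x r 2 y :=
    Finset.single_le_sum (f := fun n => ((|nint (y - x n)| + r) ^ 2)⁻¹)
      (fun i _ => by positivity) hn
  refine absurd (h.trans_le ?_) (not_lt.2 hterm)
  rw [one_div, show 4 * r ^ 2 = (r + r) ^ 2 by ring, abs_of_nonneg h0]
  gcongr

theorem volume_unitInterval_ge_le {F : ℝ → ℝ} (hF : Continuous F) (h0 : ∀ y, 0 ≤ F y)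
    {ε κ : ℝ} (hε : 0 < ε) (h : ∫ y in (0 : ℝ)..1, F y ≤ ε * κ) :
    volume ({y | ε ≤ F y} ∩ Set.Icc 0 1) ≤ ENNReal.ofReal κ := by
  have hmarkov := mul_meas_ge_le_integral_of_nonneg (μ := volume.restrict (Set.Icc (0 : ℝ) 1))
    (Eventually.of_forall h0) hF.integrableOn_Icc ε
  rw [integral_Icc_eq_integral_Ioc, ← intervalIntegral.integral_of_le zero_le_one] at hmarkov
  have hmeas : MeasurableSet {y | ε ≤ F y} := measurableSet_le measurable_const hF.measurable
  rw [← Measure.restrict_apply hmeas]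
  have hκ := le_of_mul_le_mul_left (hmarkov.trans h) hε
  exact (ENNReal.le_ofReal_iff_toReal_le (measure_ne_top _ _) (measureReal_nonneg.trans hκ)).2 hκ

theorem log_one_add_mul_le {N : ℝ} (hN : 2 ≤ N) {a : ℝ} (ha : 0 < a) :
    Real.log (1 + N * a) ≤ (1 + Real.log (1 + a) / Real.log 2) * Real.log N := by
  have h2 : 0 < Real.log 2 := Real.log_pos one_lt_two
  have hlog : Real.log 2 ≤ Real.log N := Real.log_le_log two_pos hN
  have ha' : 0 ≤ Real.log (1 + a) := Real.log_nonneg (by linarith)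
  calc Real.log (1 + N * a) ≤ Real.log (N * (1 + a)) :=
        Real.log_le_log (by positivity) (by linarith)
    _ = Real.log N + Real.log (1 + a) / Real.log 2 * Real.log 2 := by
        rw [Real.log_mul (by positivity) (by positivity), div_mul_cancel₀ _ h2.ne']
    _ ≤ Real.log N + Real.log (1 + a) / Real.log 2 * Real.log N := by gcongr
    _ = _ := by ring

/-- Lemma 4.1: for any `N ≥ 2` real numbers, outside an exceptional set of measure `≤ δ`,
the averages of `1/‖x - xₙ‖` and `1/‖x - xₙ‖²` are under control. -/
theorem average_reciprocal_distance_bound :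
    ∀ δ : ℝ, 0 < δ → ∃ C : ℝ, 0 < C ∧
      ∀ N : ℕ, 2 ≤ N → ∀ x : ℕ → ℝ,
        ∃ E : Set ℝ, E ⊆ Set.Icc 0 1 ∧ MeasurableSet E ∧ volume E ≤ ENNReal.ofReal δ ∧
          ∀ y ∈ Set.Icc (0 : ℝ) 1 \ E,
            (∀ n ∈ Finset.range N, ∀ m : ℤ, y - x n ≠ (m : ℝ)) ∧
            (1 / (N : ℝ)) * ∑ n ∈ Finset.range N, 1 / nint (y - x n) ≤ C * Real.log N ∧
            (1 / (N : ℝ) ^ 2) * ∑ n ∈ Finset.range N, 1 / nint (y - x n) ^ 2 ≤ C := by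
  intro δ hδ
  have hlog2 : 0 < Real.log 2 := Real.log_pos one_lt_two
  set A : ℝ := 1 + Real.log (1 + 8 / δ) / Real.log 2 with hA
  have hApos : 0 < A := by
    have : 0 ≤ Real.log (1 + 8 / δ) :=
      Real.log_nonneg (le_add_of_nonneg_right (by positivity))
    positivity
  refine ⟨8 / δ * A + 256 / δ ^ 2, by positivity, fun N hN x => ?_⟩
  have hN2 : (2 : ℝ) ≤ N := by exact_mod_cast hN
  have hNpos : (0 : ℝ) < N := by linarith
  have hlogN : 0 < Real.log N := Real.log_pos (by linarith)
  obtain ⟨r, hr_def⟩ : ∃ r : ℝ, r = δ / (16 * N) := ⟨_, rfl⟩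
  have hr : 0 < r := by rw [hr_def]; positivity
  set K : ℝ := N * (4 / δ * A * Real.log N) with hK
  have hKpos : 0 < K := by positivity
  have hc := fun k => continuous_regularizedSum N x hr k
  have h0 := fun k => regularizedSum_nonneg N x hr k
  refine ⟨({y | 1 / (4 * r ^ 2) ≤ regularizedSum N x r 2 y} ∩ Set.Icc 0 1) ∪
    ({y | K ≤ regularizedSum N x r 1 y} ∩ Set.Icc 0 1),
    Set.union_subset Set.inter_subset_right Set.inter_subset_right,
    ((measurableSet_le measurable_const (hc 2).measurable).inter measurableSet_Icc).union
      ((measurableSet_le measurable_const (hc 1).measurable).inter measurableSet_Icc), ?_, ?_⟩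
  · have hsq : ∫ y in (0 : ℝ)..1, regularizedSum N x r 2 y ≤ 1 / (4 * r ^ 2) * (δ / 2) := by
      rw [integral_regularizedSum N x hr]
      calc (N : ℝ) * (2 * ∫ t in (0 : ℝ)..(1 / 2), ((|t| + r) ^ 2)⁻¹) ≤ N * (2 * (1 / r)) := by
            gcongr
            exact integral_inv_abs_add_sq_le hr
        _ = 1 / (4 * r ^ 2) * (δ / 2) := by
            rw [hr_def]
            field_simp
            norm_num
    have hone : ∫ y in (0 : ℝ)..1, regularizedSum N x r 1 y ≤ K * (δ / 2) := by
      rw [integral_regularizedSum N x hr, integral_inv_abs_add hr,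
        show 1 / (2 * r) = N * (8 / δ) by rw [hr_def]; field_simp; norm_num]
      calc (N : ℝ) * (2 * Real.log (1 + N * (8 / δ))) ≤ N * (2 * (A * Real.log N)) := by
            gcongr
            exact log_one_add_mul_le hN2 (by positivity)
        _ = K * (δ / 2) := by
            rw [hK]
            field_simp
            norm_num
    calc _ ≤ ENNReal.ofReal (δ / 2) + ENNReal.ofReal (δ / 2) :=
          (measure_union_le _ _).trans (add_le_add
            (volume_unitInterval_ge_le (hc 2) (h0 2) (by positivity) hsq)
            (volume_unitInterval_ge_le (hc 1) (h0 1) hKpos hone))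
      _ = ENNReal.ofReal δ := by
          rw [← ENNReal.ofReal_add (by positivity) (by positivity), add_halves]
  · rintro y ⟨hy, hyE⟩
    have hsq : regularizedSum N x r 2 y < 1 / (4 * r ^ 2) :=
      not_le.1 fun h => hyE (Or.inl ⟨h, hy⟩)
    have hone : regularizedSum N x r 1 y < K := not_le.1 fun h => hyE (Or.inr ⟨h, hy⟩)
    have hlt : ∀ n ∈ Finset.range N, r < nint (y - x n) := fun n hn =>
      lt_nint_of_regularizedSum_lt hr hsq hn
    have hle := fun k => sum_inv_nint_pow_le hr (fun n hn => (hlt n hn).le) k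
    refine ⟨fun n hn m hm => ?_, ?_, ?_⟩
    · have h := hlt n hn
      rw [hm, nint_intCast] at h
      exact h.not_gt hr
    · have h := hle 1
      simp only [pow_one] at h
      calc (1 / (N : ℝ)) * ∑ n ∈ Finset.range N, 1 / nint (y - x n)
          ≤ 1 / (N : ℝ) * (2 * K) := by
            gcongr
            exact h.trans (by gcongr)
        _ = 8 / δ * A * Real.log N := by
            rw [hK]
            field_simp
            norm_num
        _ ≤ (8 / δ * A + 256 / δ ^ 2) * Real.log N := by
            gcongr
            exact le_add_of_nonneg_right (by positivity)
    · calc (1 / (N : ℝ) ^ 2) * ∑ n ∈ Finset.range N, 1 / nint (y - x n) ^ 2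
          ≤ 1 / (N : ℝ) ^ 2 * (2 ^ 2 * (1 / (4 * r ^ 2))) := by
            gcongr
            exact (hle 2).trans (by gcongr)
        _ = 256 / δ ^ 2 := by
            rw [hr_def]
            field_simp
            norm_num
        _ ≤ 8 / δ * A + 256 / δ ^ 2 := le_add_of_nonneg_left (by positivity)
end

section
/- Let α, β be nonzero real numbers, let γ > 1 and ε > 0, and suppose D_ε := inf_{n∈ℕ, n≥1} n^{γ+ε}·‖n·α/β‖ > 0. For a positive integer N define M := N^{(γ−1)(γ+ε)/(γ+ε−1)} · D_ε^{1/(γ+ε−1)}. Then there exists a constant C (depending only on α, β, γ, ε) such that for every ξ ∈ ℝ and every positive integer N, the sum of 1/‖n·α/β − ξ‖ over those integers 0 ≤ n ≤ N−1 satisfying ‖n·α/β − ξ‖ ≥ 1/M is at most C·N^γ. -/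
open MeasureTheory Filter

lemma nint_sub_le (x y : ℝ) : nint (x - y) ≤ nint x + nint y := by
  have h := round_le (x - y) (round x - round y)
  have h2 := abs_sub (x - round x) (y - round y)
  unfold nint
  push_cast at h
  rw [show x - round x - (y - round y) = x - y - (round x - round y) by ring] at h2
  exact h.trans h2

/-- A finite set of naturals bounded by `B` whose elements are `G`-separated has at most
`B / G + 1` elements. -/
lemma card_sub_one_mul_le_of_separated {G : ℝ} (hG : 0 ≤ G) (T : Finset ℕ) :
    (∀ m ∈ T, ∀ n ∈ T, m < n → G ≤ (n : ℝ) - m) →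
      ∀ B : ℝ, 0 ≤ B → (∀ n ∈ T, (n : ℝ) ≤ B) → ((T.card : ℝ) - 1) * G ≤ B := by
  induction T using Finset.induction_on_max with
  | empty => intro _ B hB _; simp; linarith
  | insert a T hlt ih =>
    intro hsep B hB hle
    have haT : a ∉ T := fun h => lt_irrefl _ (hlt a h)
    rw [Finset.card_insert_of_notMem haT]
    push_cast
    rcases T.eq_empty_or_nonempty with rfl | ⟨b, hb⟩
    · simpa using hB
    have hgap : ∀ n ∈ T, G ≤ (a : ℝ) - n := fun n hn =>
      hsep n (Finset.mem_insert_of_mem hn) a (Finset.mem_insert_self _ _) (hlt n hn)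
    have hb0 : (0 : ℝ) ≤ b := b.cast_nonneg
    have hcard := ih
      (fun m hm n hn => hsep m (Finset.mem_insert_of_mem hm) n (Finset.mem_insert_of_mem hn))
      (a - G) (by linarith [hgap b hb]) (fun n hn => by linarith [hgap n hn])
    linarith [hle a (Finset.mem_insert_self _ _)]

/-- If `D ≤ k ^ s * ‖k θ‖` for all `k ≥ 1`, then at most `1 + N (2 t / D) ^ (1 / s)` of the points
`n θ - ξ`, `n < N`, lie within distance `t` of an integer. -/
lemma card_filter_nint_le {θ s D : ℝ} (hs : 0 < s) (hD : 0 < D)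
    (hθ : ∀ k : ℕ, 1 ≤ k → D ≤ (k : ℝ) ^ s * nint (k * θ)) (ξ : ℝ) (N : ℕ) {t : ℝ} (ht : 0 < t) :
    (((Finset.range N).filter fun n : ℕ => nint (n * θ - ξ) ≤ t).card : ℝ) ≤
      1 + N * (2 * t / D) ^ (1 / s) := by
  have hG : 0 < (2 * t / D) ^ (1 / s) := by positivity
  have h := card_sub_one_mul_le_of_separated (inv_nonneg.2 hG.le)
    ((Finset.range N).filter fun n : ℕ => nint (n * θ - ξ) ≤ t) ?_ N N.cast_nonneg ?_
  · rw [← div_eq_mul_inv, div_le_iff₀ hG] at h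
    linarith
  · intro m hm n hn hmn
    have hm' := (Finset.mem_filter.1 hm).2
    have hn' := (Finset.mem_filter.1 hn).2
    have hk := hθ (n - m) (by omega)
    rw [Nat.cast_sub hmn.le] at hk
    have hpos : (0 : ℝ) < n - m := sub_pos.2 (Nat.cast_lt.2 hmn)
    have hclose : nint (((n : ℝ) - m) * θ) ≤ 2 * t := by
      have := nint_sub_le (n * θ - ξ) (m * θ - ξ)
      rw [show (n : ℝ) * θ - ξ - (m * θ - ξ) = (n - m) * θ by ring] at this
      linarith
    have hpow : D / (2 * t) ≤ ((n : ℝ) - m) ^ s := by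
      rw [div_le_iff₀ (by positivity)]
      exact hk.trans (by gcongr)
    rw [← Real.inv_rpow (by positivity), inv_div]
    calc (D / (2 * t)) ^ (1 / s) ≤ (((n : ℝ) - m) ^ s) ^ (1 / s) := by gcongr
      _ = (n : ℝ) - m := by rw [one_div, Real.rpow_rpow_inv hpos.le hs.ne']
  · intro n hn
    exact_mod_cast (Finset.mem_range.1 (Finset.mem_filter.1 hn).1).le

/-- Dyadic decomposition of `∑ 1 / f` over the points where `f ≥ 1 / M`. -/
lemma exists_sum_one_div_le_dyadic {ι : Type*} (S : Finset ι) (f : ι → ℝ) {M : ℝ} (hM : 0 < M) :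
    ∃ J : ℕ, ∑ n ∈ S.filter (fun n => 1 / M ≤ f n), 1 / f n ≤
      ∑ j ∈ Finset.range J,
        M / 2 ^ j * ((S.filter fun n => f n ≤ 2 ^ (j + 1) / M).card : ℝ) := by
  have hex : ∀ n, ∃ j : ℕ, 1 / M ≤ f n → 1 / f n ≤ M / 2 ^ j ∧ f n ≤ 2 ^ (j + 1) / M := by
    intro n
    by_cases hn : 1 / M ≤ f n
    · have hf : 0 < f n := lt_of_lt_of_le (by positivity) hn
      obtain ⟨j, hj, hj'⟩ := exists_nat_pow_near ((div_le_iff₀ hM).1 hn) one_lt_two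
      refine ⟨j, fun _ => ⟨?_, ?_⟩⟩
      · rw [div_le_div_iff₀ hf (by positivity)]
        linarith
      · rw [le_div_iff₀ hM]
        exact hj'.le
    · exact ⟨0, fun h => absurd h hn⟩
  choose g hg using hex
  refine ⟨S.sup g + 1, ?_⟩
  calc ∑ n ∈ S.filter (fun n => 1 / M ≤ f n), 1 / f n
      ≤ ∑ n ∈ S.filter (fun n => 1 / M ≤ f n), ∑ j ∈ Finset.range (S.sup g + 1),
          if f n ≤ 2 ^ (j + 1) / M then M / 2 ^ j else 0 := by
        refine Finset.sum_le_sum fun n hn => ?_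
        obtain ⟨hnS, hn⟩ := Finset.mem_filter.1 hn
        obtain ⟨h1, h2⟩ := hg n hn
        refine h1.trans ?_
        have := Finset.single_le_sum
          (f := fun j : ℕ => if f n ≤ 2 ^ (j + 1) / M then M / 2 ^ j else 0)
          (fun j _ => by positivity)
          (Finset.mem_range.2 (Nat.lt_succ_of_le (Finset.le_sup (f := g) hnS)))
        simpa only [if_pos h2] using this
    _ ≤ ∑ n ∈ S, ∑ j ∈ Finset.range (S.sup g + 1),
          if f n ≤ 2 ^ (j + 1) / M then M / 2 ^ j else 0 :=
        Finset.sum_le_sum_of_subset_of_nonneg (Finset.filter_subset _ _)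
          fun n _ _ => Finset.sum_nonneg fun j _ => by positivity
    _ = _ := by
        rw [Finset.sum_comm]
        refine Finset.sum_congr rfl fun j _ => ?_
        rw [← Finset.sum_filter, Finset.sum_const, nsmul_eq_mul, mul_comm]

lemma sum_range_pow_le {r : ℝ} (h0 : 0 ≤ r) (h1 : r < 1) (J : ℕ) :
    ∑ j ∈ Finset.range J, r ^ j ≤ 1 / (1 - r) := by
  rw [one_div, ← tsum_geometric_of_lt_one h0 h1]
  exact (summable_geometric_of_lt_one h0 h1).sum_le_tsum _ fun j _ => by positivity

/-- The sum estimate for an arbitrary cutoff `M`. -/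
lemma sum_one_div_nint_le {θ s D : ℝ} (hs : 1 < s) (hD : 0 < D)
    (hθ : ∀ k : ℕ, 1 ≤ k → D ≤ (k : ℝ) ^ s * nint (k * θ)) (ξ : ℝ) (N : ℕ) {M : ℝ} (hM : 0 < M) :
    ∑ n ∈ (Finset.range N).filter (fun n : ℕ => 1 / M ≤ nint (n * θ - ξ)),
        1 / nint (n * θ - ξ) ≤
      2 * M + N * (M * (4 / (M * D)) ^ (1 / s)) * (1 / (1 - 2 ^ (1 / s) / 2)) := by
  obtain ⟨J, hJ⟩ := exists_sum_one_div_le_dyadic (Finset.range N)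
    (fun n : ℕ => nint (n * θ - ξ)) hM
  have hr : (2 : ℝ) ^ (1 / s) / 2 < 1 := by
    rw [div_lt_one two_pos]
    exact Real.rpow_lt_self_of_one_lt one_lt_two ((div_lt_one (by linarith)).2 hs)
  calc _ ≤ _ := hJ
    _ ≤ ∑ j ∈ Finset.range J, (M * (1 / 2) ^ j +
          N * (M * (4 / (M * D)) ^ (1 / s)) * (2 ^ (1 / s) / 2) ^ j) := by
        refine Finset.sum_le_sum fun j _ => ?_
        have hcard := card_filter_nint_le (by linarith) hD hθ ξ N
          (t := 2 ^ (j + 1) / M) (by positivity)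
        have hsplit : (2 * ((2 : ℝ) ^ (j + 1) / M) / D) ^ (1 / s) =
            (4 / (M * D)) ^ (1 / s) * (2 ^ (1 / s)) ^ j := by
          rw [Real.rpow_pow_comm two_pos.le, ← Real.mul_rpow (by positivity) (by positivity)]
          congr 1
          field_simp
          ring
        rw [hsplit] at hcard
        calc _ ≤ M / 2 ^ j * (1 + N * ((4 / (M * D)) ^ (1 / s) * (2 ^ (1 / s)) ^ j)) := by gcongr
          _ = _ := by rw [div_pow, div_pow, one_pow]; ring
    _ ≤ _ := by
        rw [Finset.sum_add_distrib, ← Finset.mul_sum, ← Finset.mul_sum]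
        have h2 := sum_range_pow_le (r := 1 / 2) (by norm_num) (by norm_num) J
        have hr' := sum_range_pow_le (by positivity) hr J
        norm_num at h2
        rw [mul_comm 2 M]
        norm_num
        simp only [one_div] at hr'
        gcongr

/-- Lemma 4.2: under the Diophantine condition `D_ε := inf_{n≥1} n^{γ+ε} ‖n α/β‖ > 0`,
the sum of `1/‖n α/β - ξ‖` over `0 ≤ n ≤ N-1` with `‖n α/β - ξ‖ ≥ 1/M` is `O(N^γ)`,
where `M := N^{(γ-1)(γ+ε)/(γ+ε-1)} D_ε^{1/(γ+ε-1)}`. -/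
theorem diophantine_sum_bound
    (α β : ℝ) (hα : α ≠ 0) (hβ : β ≠ 0) (γ ε : ℝ) (hγ : 1 < γ) (hε : 0 < ε)
    (Dε : ℝ)
    (hDdef : Dε = sInf {y : ℝ | ∃ n : ℕ, 1 ≤ n ∧
      y = (n : ℝ) ^ (γ + ε) * nint ((n : ℝ) * (α / β))})
    (hDpos : 0 < Dε) :
    ∃ C : ℝ, ∀ ξ : ℝ, ∀ N : ℕ, 1 ≤ N →
      ∑ n ∈ (Finset.range N).filter (fun n : ℕ =>
          1 / ((N : ℝ) ^ ((γ - 1) * (γ + ε) / (γ + ε - 1)) * Dε ^ (1 / (γ + ε - 1)))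
            ≤ nint ((n : ℝ) * (α / β) - ξ)),
        1 / nint ((n : ℝ) * (α / β) - ξ) ≤ C * (N : ℝ) ^ γ := by
  have hs : 1 < γ + ε := by linarith
  have hθ : ∀ k : ℕ, 1 ≤ k → Dε ≤ (k : ℝ) ^ (γ + ε) * nint (k * (α / β)) := by
    intro k hk
    rw [hDdef]
    refine csInf_le ⟨0, ?_⟩ ⟨k, hk, rfl⟩
    rintro _ ⟨n, -, rfl⟩
    exact mul_nonneg (by positivity) (abs_nonneg _)
  refine ⟨2 * Dε ^ (1 / (γ + ε - 1)) +
    4 ^ (1 / (γ + ε)) * (1 / (1 - 2 ^ (1 / (γ + ε)) / 2)), fun ξ N hN => ?_⟩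
  have hN1 : (1 : ℝ) ≤ N := Nat.one_le_cast.2 hN
  have hN0 : (0 : ℝ) < N := by linarith
  have hs' : 0 < γ + ε - 1 := by linarith
  set s := γ + ε
  set M : ℝ := (N : ℝ) ^ ((γ - 1) * s / (s - 1)) * Dε ^ (1 / (s - 1)) with hM_def
  have hM : 0 < M := by positivity
  have hM_le : M ≤ (N : ℝ) ^ γ * Dε ^ (1 / (s - 1)) := by
    rw [hM_def]
    gcongr
    rw [div_le_iff₀ hs']
    nlinarith
  have hmain : N * (M * (4 / (M * Dε)) ^ (1 / s)) = 4 ^ (1 / s) * (N : ℝ) ^ γ := by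
    have hMpow : M ^ (1 - 1 / s) = (N : ℝ) ^ (γ - 1) * Dε ^ (1 / s) := by
      rw [hM_def, Real.mul_rpow (by positivity) (by positivity), ← Real.rpow_mul hN0.le,
        ← Real.rpow_mul hDpos.le]
      have hs0 : s ≠ 0 := by linarith
      congr 2 <;> field_simp
    rw [Real.rpow_sub hM, Real.rpow_one, div_eq_iff (by positivity)] at hMpow
    rw [Real.div_rpow (by positivity) (by positivity), Real.mul_rpow hM.le hDpos.le]
    have hNpow : (N : ℝ) ^ γ = N * (N : ℝ) ^ (γ - 1) := by
      rw [Real.rpow_sub_one hN0.ne']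
      field_simp
    rw [mul_div_assoc', mul_div_assoc', div_eq_iff (by positivity), hNpow]
    linear_combination (N * 4 ^ (1 / s) : ℝ) * hMpow
  have hsum := sum_one_div_nint_le hs hDpos hθ ξ N hM
  rw [hmain] at hsum
  linarith
end
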